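/- Let n be a positive integer, let K be a compact metric space with dim_T K ≥ n, and let dim_* be one of dim_T, dim_H, dim_P. Then there exists a G_δ set G ⊆ K with dim_* G = d^n_*(K) such that for a generic f ∈ C(K,ℝⁿ) the following hold: (i) for every y ∈ ℝⁿ the set f⁻¹(y) ∖ G has at most n points, and consequently dim_* f⁻¹(y) ≤ d^n_*(K) for every y ∈ ℝⁿ; (ii) for every d < d^n_*(K) there exists a non-empty open set U_{f,d} ⊆ ℝⁿ such that dim_* f⁻¹(y) ≥ d for all y ∈ U_{f,d}. -/

import Mathlib

open Set Metric Filter Topology TopologicalSpace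
open scoped ENNReal NNReal

noncomputable section

universe u

/-- `indBelow n X` means that the small inductive (topological) dimension of `X`
is at most `n - 1`; in particular `indBelow 0 X` means `X = ∅`. -/
def indBelow : ℕ → ∀ (X : Type u) [TopologicalSpace X], Prop
  | 0, X, _ => IsEmpty X
  | n + 1, X, inst =>
      letI := inst
      ∀ (x : X) (U : Set X), IsOpen U → x ∈ U →
        ∃ V : Set X, IsOpen V ∧ x ∈ V ∧ V ⊆ U ∧ indBelow n ↥(frontier V)

/-- The small inductive (topological) dimension, with values in `EReal`:
`-1` for the empty space and `⊤` if there is no finite bound. -/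
def indDim (X : Type u) [TopologicalSpace X] : EReal :=
  sInf {d : EReal | ∃ n : ℕ, indBelow n X ∧ d = (n : EReal) - 1}

variable {X : Type u} [MetricSpace X]

/-- Topological dimension of a subset of a metric space. -/
def tdim (A : Set X) : EReal := indDim ↥A

open Classical in
/-- Hausdorff dimension of a subset of a metric space,
with the convention `dim ∅ = -1`. -/
def hdim (A : Set X) : EReal := if A = ∅ then -1 else ((dimH A : ℝ≥0∞) : EReal)

/-- A `δ`-packing of `A`: a countable family of pairwise disjoint closed balls
with centers in `A` and radii at most `δ`. -/
def IsPacking (A : Set X) (δ : ℝ≥0) (s : Set (X × ℝ≥0)) : Prop :=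
  s.Countable ∧ (∀ p ∈ s, p.1 ∈ A ∧ p.2 ≤ δ) ∧
    s.Pairwise fun p q => Disjoint (closedBall p.1 (p.2 : ℝ)) (closedBall q.1 (q.2 : ℝ))

/-- The packing pre-measure `P^h_δ(A)`. -/
def packPre (h : ℝ≥0 → ℝ≥0) (A : Set X) (δ : ℝ≥0) : ℝ≥0∞ :=
  ⨆ (s : Set (X × ℝ≥0)) (_ : IsPacking A δ s), ∑' p : s, ((h p.1.2 : ℝ≥0) : ℝ≥0∞)

/-- The packing pre-measure (packing number) `P^h₀(A) = lim_{δ → 0+} P^h_δ(A)`. -/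
def packPre0 (h : ℝ≥0 → ℝ≥0) (A : Set X) : ℝ≥0∞ :=
  ⨅ (δ : ℝ≥0) (_ : 0 < δ), packPre h A δ

/-- The `h`-packing measure `𝒫^h(A)`. -/
def packMeasure (h : ℝ≥0 → ℝ≥0) (A : Set X) : ℝ≥0∞ :=
  ⨅ (c : ℕ → Set X) (_ : A = ⋃ i, c i), ∑' i, packPre0 h (c i)

open Classical in
/-- The packing dimension, with the convention `dim ∅ = -1`. -/
def pdim (A : Set X) : EReal :=
  if A = ∅ then -1
  else max 0 (⨆ (s : ℝ≥0) (_ : packMeasure (fun r => r ^ (s : ℝ)) A = ∞), ((s : ℝ) : EReal))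

/-- The restriction of the packing measure `𝒫^h` to `A` is σ-finite. -/
def PackSigmaFiniteOn (h : ℝ≥0 → ℝ≥0) (A : Set X) : Prop :=
  ∃ c : ℕ → Set X, A ⊆ ⋃ i, c i ∧ ∀ i, packMeasure h (A ∩ c i) < ∞

/-- The generalized Hausdorff measure `ℋ^h(A)` associated to a gauge function `h`. -/
def hMeasure (h : ℝ≥0 → ℝ≥0) (A : Set X) : ℝ≥0∞ :=
  ⨆ (δ : ℝ≥0) (_ : 0 < δ),
    ⨅ (c : ℕ → Set X) (_ : A ⊆ ⋃ i, c i) (_ : ∀ i, EMetric.diam (c i) ≤ (δ : ℝ≥0∞)),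
      ∑' i, ((h (EMetric.diam (c i)).toNNReal : ℝ≥0) : ℝ≥0∞)

/-- `F` is an `F_σ` subset of the subspace `A`. -/
def IsFSigmaIn (F A : Set X) : Prop :=
  ∃ C : ℕ → Set X, (∀ i, IsClosed (C i)) ∧ F = ⋃ i, C i ∩ A

/-- `d^n_*(A) = inf {dim_*(A ∖ F) : F ⊆ A is F_σ in A and dim_T F ≤ n - 1}`. -/
def dStar (dim : Set X → EReal) (n : ℕ) (A : Set X) : EReal :=
  sInf {d : EReal |
    ∃ F : Set X, IsFSigmaIn F A ∧ tdim F ≤ (n : EReal) - 1 ∧ d = dim (A \ F)}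

end

namespace GenericFibers

section ZeroDimensional

variable {X Y : Type*}

/-- `Z` is zero-dimensional (or empty), expressed through open sets of the ambient space. -/
def ZeroDim [TopologicalSpace X] (Z : Set X) : Prop :=
  ∀ x ∈ Z, ∀ U, IsOpen U → x ∈ U → ∃ V, IsOpen V ∧ x ∈ V ∧ V ⊆ U ∧ Disjoint (frontier V) Z

lemma ZeroDim.mono [TopologicalSpace X] {Z Z' : Set X} (h : ZeroDim Z') (hs : Z ⊆ Z') :
    ZeroDim Z := fun x hx U hU hxU => by
  obtain ⟨V, h1, h2, h3, h4⟩ := h x (hs hx) U hU hxU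
  exact ⟨V, h1, h2, h3, h4.mono_right hs⟩

lemma ZeroDim.preimage [TopologicalSpace X] [TopologicalSpace Y] {e : Y → X} (he : IsInducing e)
    {T : Set X} (h : ZeroDim T) : ZeroDim (e ⁻¹' T) := fun y hy U hU hyU => by
  obtain ⟨U', hU', rfl⟩ := he.isOpen_iff.1 hU
  obtain ⟨V, h1, h2, h3, h4⟩ := h (e y) hy U' hU' hyU
  refine ⟨e ⁻¹' V, h1.preimage he.continuous, h2, preimage_mono h3, ?_⟩
  exact (h4.preimage e).mono_left (he.continuous.frontier_preimage_subset V)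

/-- A relatively clopen subset of a subset of a metric space is cut out by an open set whose
frontier misses the subset. -/
lemma exists_isOpen_separating [MetricSpace X] {S T : Set X} (hST : Disjoint (closure S) T)
    (hTS : Disjoint S (closure T)) {x : X} {ε : ℝ} (hε : 0 < ε) (hS : S ⊆ ball x (ε / 2)) :
    ∃ W, IsOpen W ∧ S ⊆ W ∧ W ⊆ ball x ε ∧ Disjoint (frontier W) (S ∪ T) := by
  refine ⟨{z | infEDist z S < min (infEDist z T) (ENNReal.ofReal (ε / 2))}, ?_, ?_, ?_, ?_⟩
  · exact isOpen_lt continuous_infEDist (continuous_infEDist.min continuous_const)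
  · intro z hz
    have h0 : infEDist z S = 0 := infEDist_zero_of_mem hz
    have h1 : 0 < infEDist z T := by
      rw [pos_iff_ne_zero, Ne, ← mem_closure_iff_infEDist_zero]
      exact disjoint_left.1 hTS hz
    simp only [mem_ofPred_eq, h0]
    exact lt_min h1 (by simpa using hε)
  · intro z hz
    rw [mem_ofPred_eq] at hz
    have hz' := (lt_min_iff.1 hz).2
    obtain ⟨s, hs, hzs⟩ := infEDist_lt_iff.1 hz'
    have h1 : dist z s < ε / 2 := by
      rw [edist_dist] at hzs
      exact (ENNReal.ofReal_lt_ofReal_iff (by positivity)).1 hzs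
    have h2 := hS hs
    rw [mem_ball] at h2 ⊢
    linarith [dist_triangle z s x]
  · have hWo : IsOpen {z | infEDist z S < min (infEDist z T) (ENNReal.ofReal (ε / 2))} :=
      isOpen_lt continuous_infEDist (continuous_infEDist.min continuous_const)
    rw [disjoint_left]
    rintro z hz (hzS | hzT)
    · rw [hWo.frontier_eq] at hz
      apply hz.2
      have h0 : infEDist z S = 0 := infEDist_zero_of_mem hzS
      have h1 : 0 < infEDist z T := by
        rw [pos_iff_ne_zero, Ne, ← mem_closure_iff_infEDist_zero]
        exact disjoint_left.1 hTS hzS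
      simp only [mem_ofPred_eq, h0]
      exact lt_min h1 (by simpa using hε)
    · have h0 : infEDist z T = 0 := infEDist_zero_of_mem hzT
      have h1 : 0 < infEDist z S := by
        rw [pos_iff_ne_zero, Ne, ← mem_closure_iff_infEDist_zero]
        exact disjoint_right.1 hST hzT
      have h2 : IsOpen {z | infEDist z T < infEDist z S} :=
        isOpen_lt continuous_infEDist continuous_infEDist
      have h3 : z ∈ {z | infEDist z T < infEDist z S} := by simpa [h0] using h1
      obtain ⟨w, hw1, hw2⟩ := mem_closure_iff.1 hz.1 _ h2 h3
      rw [mem_ofPred_eq] at hw1 hw2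
      exact lt_asymm hw1 (lt_min_iff.1 hw2).1

lemma ZeroDim.image [MetricSpace X] [TopologicalSpace Y] {e : Y → X} (he : IsInducing e)
    {S : Set Y} (h : ZeroDim S) : ZeroDim (e '' S) := by
  rintro _ ⟨y, hy, rfl⟩ U hU hyU
  obtain ⟨ε, hε, hεU⟩ := Metric.isOpen_iff.1 hU _ hyU
  obtain ⟨V, h1, h2, h3, h4⟩ := h y hy (e ⁻¹' ball (e y) (ε / 2))
    (isOpen_ball.preimage he.continuous) (mem_ball_self (by positivity))
  have hcl : ∀ A : Set Y, closure A = e ⁻¹' closure (e '' A) := fun A =>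
    he.closure_eq_preimage_closure_image A
  have hd1 : Disjoint (closure (e '' (S ∩ V))) (e '' (S \ V)) := by
    rw [disjoint_right]
    rintro _ ⟨z, ⟨hz, hzV⟩, rfl⟩ hc
    have hz' : z ∈ closure (S ∩ V) := by rw [hcl]; exact hc
    have hz2 : z ∈ closure V := closure_mono inter_subset_right hz'
    exact disjoint_left.1 h4 (by rw [h1.frontier_eq]; exact ⟨hz2, hzV⟩) hz
  have hd2 : Disjoint (e '' (S ∩ V)) (closure (e '' (S \ V))) := by
    rw [disjoint_left]
    rintro _ ⟨z, ⟨hz, hzV⟩, rfl⟩ hc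
    have hz' : z ∈ closure (S \ V) := by rw [hcl]; exact hc
    obtain ⟨w, hw, hw'⟩ := mem_closure_iff.1 hz' V h1 hzV
    exact hw'.2 hw
  have hsub : e '' (S ∩ V) ⊆ ball (e y) (ε / 2) := by
    rintro _ ⟨z, ⟨hz, hzV⟩, rfl⟩
    exact h3 hzV
  obtain ⟨W, w1, w2, w3, w4⟩ := exists_isOpen_separating hd1 hd2 hε hsub
  refine ⟨W, w1, w2 ⟨y, ⟨hy, h2⟩, rfl⟩, w3.trans hεU, ?_⟩
  rwa [← image_union, inter_union_sdiff] at w4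

lemma ZeroDim.exists_disjoint_refinement [TopologicalSpace X] [SecondCountableTopology X]
    {Z : Set X} (h : ZeroDim Z) (U : X → Set X) (hU : ∀ x ∈ Z, IsOpen (U x) ∧ x ∈ U x) :
    ∃ W : ℕ → Set X, (∀ j, IsOpen (W j)) ∧ Pairwise (Function.onFun Disjoint W) ∧
      Z ⊆ ⋃ j, W j ∧ ∀ j, W j = ∅ ∨ ∃ x ∈ Z, W j ⊆ U x := by
  rcases Z.eq_empty_or_nonempty with rfl | ⟨x₀, hx₀⟩
  · exact ⟨fun _ => ∅, by simp, fun _ _ _ => by simp [Function.onFun], by simp, by simp⟩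
  have h' : ∀ x, ∃ V, x ∈ Z → IsOpen V ∧ x ∈ V ∧ V ⊆ U x ∧ Disjoint (frontier V) Z := by
    intro x
    by_cases hx : x ∈ Z
    · obtain ⟨V, hV⟩ := h x hx (U x) (hU x hx).1 (hU x hx).2
      exact ⟨V, fun _ => hV⟩
    · exact ⟨∅, fun h => absurd h hx⟩
  choose V hV using h'
  obtain ⟨t, htZ, htc, ht⟩ := countable_cover_nhdsWithin (s := Z) (f := V)
    (fun x hx => mem_nhdsWithin_of_mem_nhds ((hV x hx).1.mem_nhds (hV x hx).2.1))
  have htne : t.Nonempty := by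
    obtain ⟨y, hy, -⟩ := mem_iUnion₂.1 (ht hx₀)
    exact ⟨y, hy⟩
  obtain ⟨g, rfl⟩ := htc.exists_eq_range htne
  have hg : ∀ j, g j ∈ Z := fun j => htZ (mem_range_self j)
  refine ⟨fun j => V (g j) \ ⋃ k ∈ Finset.range j, closure (V (g k)), ?_, ?_, ?_, ?_⟩
  · intro j
    exact (hV _ (hg j)).1.sdiff (isClosed_biUnion_finset fun _ _ => isClosed_closure)
  · have key : ∀ j k, j < k → Disjoint (V (g j) \ ⋃ k ∈ Finset.range j, closure (V (g k)))
        (V (g k) \ ⋃ i ∈ Finset.range k, closure (V (g i))) := by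
      intro j k hjk
      rw [disjoint_left]
      rintro z hz hz'
      apply hz'.2
      simp only [mem_iUnion, Finset.mem_range]
      exact ⟨j, hjk, subset_closure hz.1⟩
    intro j k hjk
    rcases lt_or_gt_of_ne hjk with h | h
    · exact key j k h
    · exact (key k j h).symm
  · intro z hz
    have hex : ∃ j, z ∈ V (g j) := by
      obtain ⟨y, ⟨j, rfl⟩, hj⟩ := mem_iUnion₂.1 (ht hz)
      exact ⟨j, hj⟩
    classical
    refine mem_iUnion.2 ⟨Nat.find hex, Nat.find_spec hex, ?_⟩
    simp only [mem_iUnion, Finset.mem_range, not_exists]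
    intro k hk hzk
    have h1 : z ∉ V (g k) := Nat.find_min hex hk
    exact disjoint_left.1 (hV _ (hg k)).2.2.2
      (by rw [(hV _ (hg k)).1.frontier_eq]; exact ⟨hzk, h1⟩) hz
  · exact fun j => Or.inr ⟨g j, hg j, sdiff_subset.trans (hV _ (hg j)).2.2.1⟩

lemma ZeroDim.exists_closed_partition [TopologicalSpace X] [SecondCountableTopology X]
    {F A B : Set X} (h : ZeroDim F) (hF : IsClosed F) (hA : IsClosed A) (hB : IsClosed B)
    (hAB : Disjoint A B) :
    ∃ P Q, IsClosed P ∧ IsClosed Q ∧ Disjoint P Q ∧ P ∪ Q = F ∧ Disjoint P B ∧ Disjoint Q A := by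
  classical
  obtain ⟨W, hWo, hWd, hWc, hWU⟩ := h.exists_disjoint_refinement
    (fun x => if x ∈ A then Bᶜ else Aᶜ) (fun x _ => by
      by_cases hx : x ∈ A
      · simp [hx, hB, disjoint_left.1 hAB hx]
      · simp [hx, hA])
  set P := F ∩ ⋃ j ∈ {j | Disjoint (W j) B}, W j
  set Q := F ∩ ⋃ j ∈ {j | ¬ Disjoint (W j) B}, W j
  have hd : Disjoint P Q := by
    rw [disjoint_left]
    rintro z ⟨-, hz⟩ ⟨-, hz'⟩
    obtain ⟨j, hj, hzj⟩ := mem_iUnion₂.1 hz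
    obtain ⟨k, hk, hzk⟩ := mem_iUnion₂.1 hz'
    have : j = k := by
      by_contra hne
      exact disjoint_left.1 (hWd hne) hzj hzk
    exact hk (this ▸ hj)
  have hu : P ∪ Q = F := by
    apply subset_antisymm (union_subset inter_subset_left inter_subset_left)
    intro z hz
    obtain ⟨j, hj⟩ := mem_iUnion.1 (hWc hz)
    by_cases hjB : Disjoint (W j) B
    · exact Or.inl ⟨hz, mem_iUnion₂.2 ⟨j, hjB, hj⟩⟩
    · exact Or.inr ⟨hz, mem_iUnion₂.2 ⟨j, hjB, hj⟩⟩
  have hP : P = F \ ⋃ j ∈ {j | ¬ Disjoint (W j) B}, W j := by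
    apply subset_antisymm
    · exact fun z hz => ⟨hz.1, fun hz' => disjoint_left.1 hd hz ⟨hz.1, hz'⟩⟩
    · rintro z ⟨hz, hz'⟩
      rw [← hu] at hz
      exact hz.resolve_right fun h => hz' h.2
  have hQ : Q = F \ ⋃ j ∈ {j | Disjoint (W j) B}, W j := by
    apply subset_antisymm
    · exact fun z hz => ⟨hz.1, fun hz' => disjoint_right.1 hd hz ⟨hz.1, hz'⟩⟩
    · rintro z ⟨hz, hz'⟩
      rw [← hu] at hz
      exact hz.resolve_left fun h => hz' h.2
  refine ⟨P, Q, ?_, ?_, hd, hu, ?_, ?_⟩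
  · rw [hP]
    exact hF.sdiff (isOpen_biUnion fun j _ => hWo j)
  · rw [hQ]
    exact hF.sdiff (isOpen_biUnion fun j _ => hWo j)
  · rw [disjoint_left]
    rintro z ⟨-, hz⟩ hzB
    obtain ⟨j, hj, hzj⟩ := mem_iUnion₂.1 hz
    exact disjoint_left.1 hj hzj hzB
  · rw [disjoint_left]
    rintro z ⟨-, hz⟩ hzA
    obtain ⟨j, hj, hzj⟩ := mem_iUnion₂.1 hz
    rcases hWU j with h0 | ⟨x, -, hx⟩
    · simp [h0] at hzj
    · by_cases hxA : x ∈ A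
      · simp only [hxA, if_true] at hx
        exact hj (disjoint_left.2 fun w hw => hx hw)
      · simp only [hxA, if_false] at hx
        exact hx hzj hzA

private lemma exists_open_disjoint_closure [TopologicalSpace X] [NormalSpace X] {P Q : Set X}
    (hP : IsClosed P) (hQ : IsClosed Q) (h : Disjoint P Q) :
    ∃ E H, IsOpen E ∧ IsOpen H ∧ Disjoint (closure E) (closure H) ∧ P ⊆ E ∧ Q ⊆ H := by
  obtain ⟨E, hE, hPE, hEQ⟩ := normal_exists_closure_subset hP hQ.isOpen_compl
    h.subset_compl_right
  obtain ⟨H, hH, hQH, hHE⟩ := normal_exists_closure_subset hQ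
    (isClosed_closure (s := E)).isOpen_compl (subset_compl_comm.1 hEQ)
  exact ⟨E, H, hE, hH, (disjoint_left.2 fun z hz hz' => hHE hz' hz), hPE, hQH⟩

lemma zeroDim_univ_of_iUnion_closed [TopologicalSpace X] [SecondCountableTopology X]
    [NormalSpace X] [T1Space X] {C : ℕ → Set X} (hC : ∀ j, IsClosed (C j)) (hz : ∀ j, ZeroDim (C j))
    (hu : ⋃ j, C j = univ) : ZeroDim (univ : Set X) := by
  intro x _ U hU hxU
  let T := {p : Set X × Set X // IsOpen p.1 ∧ IsOpen p.2 ∧ Disjoint (closure p.1) (closure p.2)}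
  have step : ∀ (i : ℕ) (p : T), ∃ p' : T, p.1.1 ⊆ p'.1.1 ∧ p.1.2 ⊆ p'.1.2 ∧
      C i ⊆ p'.1.1 ∪ p'.1.2 := by
    rintro i ⟨⟨E, H⟩, hE, hH, hd⟩
    obtain ⟨P, Q, hP, hQ, hPQ, hPQu, hPH, hQE⟩ :=
      (hz i).exists_closed_partition (hC i) isClosed_closure isClosed_closure hd
    obtain ⟨E', H', hE', hH', hd', h1, h2⟩ := exists_open_disjoint_closure
      (P := closure E ∪ P) (Q := closure H ∪ Q) (isClosed_closure.union hP)
      (isClosed_closure.union hQ) (by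
        rw [disjoint_union_left, disjoint_union_right, disjoint_union_right]
        exact ⟨⟨hd, hQE.symm⟩, hPH, hPQ⟩)
    refine ⟨⟨(E', H'), hE', hH', hd'⟩, ?_, ?_, ?_⟩
    · exact subset_closure.trans (subset_union_left.trans h1)
    · exact subset_closure.trans (subset_union_left.trans h2)
    · rw [← hPQu]
      exact union_subset_union (subset_union_right.trans h1) (subset_union_right.trans h2)
  choose next hn1 hn2 hn3 using step
  obtain ⟨E₀, H₀, hE₀, hH₀, hd₀, hx₀, hU₀⟩ := exists_open_disjoint_closure
    (isClosed_singleton (x := x)) hU.isClosed_compl (by simpa using hxU)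
  let p : ℕ → T := fun i => Nat.rec ⟨(E₀, H₀), hE₀, hH₀, hd₀⟩ (fun i q => next i q) i
  have hp : ∀ i, p (i + 1) = next i (p i) := fun i => rfl
  have m1 : Monotone fun i => (p i).1.1 := monotone_nat_of_le_succ fun i => by
    rw [hp]; exact hn1 i (p i)
  have m2 : Monotone fun i => (p i).1.2 := monotone_nat_of_le_succ fun i => by
    rw [hp]; exact hn2 i (p i)
  have hdis : ∀ i j z, z ∈ (p i).1.1 → z ∈ (p j).1.2 → False := by
    intro i j z hi hj
    have h1 := m1 (le_max_left i j) hi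
    have h2 := m2 (le_max_right i j) hj
    exact disjoint_left.1 (p (max i j)).2.2.2 (subset_closure h1) (subset_closure h2)
  have hV : IsOpen (⋃ i, (p i).1.1) := isOpen_iUnion fun i => (p i).2.1
  refine ⟨⋃ i, (p i).1.1, hV, mem_iUnion.2 ⟨0, hx₀ rfl⟩, ?_, ?_⟩
  · intro z hz
    obtain ⟨i, hi⟩ := mem_iUnion.1 hz
    by_contra hzU
    exact hdis i 0 z hi (hU₀ hzU)
  · rw [disjoint_left]
    intro z hz _
    rw [hV.frontier_eq] at hz
    obtain ⟨i, hi⟩ := mem_iUnion.1 (hu.symm ▸ mem_univ z : z ∈ ⋃ j, C j)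
    have := hn3 i (p i) hi
    rw [← hp] at this
    rcases this with h | h
    · exact hz.2 (mem_iUnion.2 ⟨i + 1, h⟩)
    · obtain ⟨w, hw1, hw2⟩ := mem_closure_iff.1 hz.1 _ (p (i + 1)).2.2.1 h
      obtain ⟨j, hj⟩ := mem_iUnion.1 hw2
      exact hdis j (i + 1) w hj hw1

variable [MetricSpace X] [SecondCountableTopology X]

lemma zeroDim_of_closed_cover {Z : Set X} {C : ℕ → Set X}
    (hC : ∀ j, IsClosed (C j)) (hZ : Z ⊆ ⋃ j, C j) (hz : ∀ j, ZeroDim (Z ∩ C j)) : ZeroDim Z := by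
  have h1 : ZeroDim (univ : Set Z) := by
    refine zeroDim_univ_of_iUnion_closed (C := fun j => (Subtype.val : Z → X) ⁻¹' C j)
      (fun j => (hC j).preimage continuous_subtype_val) (fun j => ?_) ?_
    · exact ((hz j).preimage IsInducing.subtypeVal).mono fun z hz => ⟨z.2, hz⟩
    · rw [← preimage_iUnion]
      exact eq_univ_of_forall fun z => hZ z.2
  simpa using h1.image IsInducing.subtypeVal

lemma zeroDim_of_disjointed_cover {Z : Set X} {C : ℕ → Set X}
    (hC : ∀ j, IsClosed (C j)) (hZ : Z ⊆ ⋃ j, C j) (hz : ∀ j, ZeroDim (Z ∩ disjointed C j)) :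
    ZeroDim Z := by
  have h : ∀ j, ∃ D : ℕ → Set X, (∀ i, IsClosed (D i)) ∧ disjointed C j = ⋃ i, D i := by
    intro j
    rw [disjointed_eq_inter_compl]
    have ho : IsOpen (⋂ i < j, (C i)ᶜ) := by
      simp only [← compl_iUnion]
      exact (Set.Finite.isClosed_biUnion (finite_lt_nat j) fun i _ => hC i).isOpen_compl
    obtain ⟨D, hD, -, hDu, -⟩ := ho.exists_iUnion_isClosed
    exact ⟨fun i => C j ∩ D i, fun i => (hC j).inter (hD i), by rw [← inter_iUnion, hDu]⟩
  choose D hD hDu using h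
  refine zeroDim_of_closed_cover (C := fun p => D p.unpair.1 p.unpair.2) (fun p => hD _ _) ?_ ?_
  · intro z hz
    have := hZ hz
    rw [← iUnion_disjointed] at this
    obtain ⟨j, hj⟩ := mem_iUnion.1 this
    rw [hDu] at hj
    obtain ⟨i, hi⟩ := mem_iUnion.1 hj
    exact mem_iUnion.2 ⟨Nat.pair j i, by simpa using hi⟩
  · intro p
    refine (hz p.unpair.1).mono (inter_subset_inter_right _ ?_)
    rw [hDu]
    exact subset_iUnion _ _

end ZeroDimensional

section DimLt

variable {X : Type*}

lemma zeroDim_empty [TopologicalSpace X] : ZeroDim (∅ : Set X) := fun _ h => h.elim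

lemma zeroDim_singleton [TopologicalSpace X] [R1Space X] [RegularSpace X] (x : X) :
    ZeroDim ({x} : Set X) := by
  rintro _ rfl U hU hxU
  refine ⟨U, hU, hxU, subset_rfl, ?_⟩
  rw [disjoint_singleton_right, hU.frontier_eq]
  exact fun h => h.2 hxU

/-- `A` is covered by `m` zero-dimensional sets; for subsets of separable metric spaces this says
that the topological dimension of `A` is less than `m`. -/
def DimLt [TopologicalSpace X] (m : ℕ) (A : Set X) : Prop :=
  ∃ Z : Fin m → Set X, (∀ i, ZeroDim (Z i)) ∧ A ⊆ ⋃ i, Z i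

lemma DimLt.mono [TopologicalSpace X] {m : ℕ} {A B : Set X} (h : DimLt m B) (hAB : A ⊆ B) :
    DimLt m A := by
  obtain ⟨Z, hZ, hB⟩ := h
  exact ⟨Z, hZ, hAB.trans hB⟩

lemma DimLt.of_le [TopologicalSpace X] {m k : ℕ} {A : Set X} (h : DimLt m A) (hmk : m ≤ k) :
    DimLt k A := by
  obtain ⟨Z, hZ, hA⟩ := h
  refine ⟨fun i => if hi : i.1 < m then Z ⟨i.1, hi⟩ else ∅, fun i => ?_, fun x hx => ?_⟩
  · by_cases hi : i.1 < m
    · simpa [hi] using hZ ⟨i.1, hi⟩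
    · simpa [hi] using zeroDim_empty
  · obtain ⟨i, hi⟩ := mem_iUnion.1 (hA hx)
    refine mem_iUnion.2 ⟨⟨i.1, i.2.trans_le hmk⟩, ?_⟩
    simpa using hi

lemma dimLt_zero_iff [TopologicalSpace X] {A : Set X} : DimLt 0 A ↔ A = ∅ := by
  constructor
  · rintro ⟨Z, -, hA⟩
    simpa using hA
  · rintro rfl
    exact ⟨fun _ => ∅, fun _ => zeroDim_empty, empty_subset _⟩

lemma ZeroDim.dimLt_one [TopologicalSpace X] {A : Set X} (h : ZeroDim A) : DimLt 1 A :=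
  ⟨fun _ => A, fun _ => h, fun _ hx => mem_iUnion.2 ⟨0, hx⟩⟩

lemma DimLt.union_zeroDim [TopologicalSpace X] {m : ℕ} {A B : Set X} (h : DimLt m A)
    (hB : ZeroDim B) : DimLt (m + 1) (A ∪ B) := by
  obtain ⟨Z, hZ, hA⟩ := h
  refine ⟨Fin.cons B Z, fun i => ?_, ?_⟩
  · refine Fin.cases ?_ (fun j => ?_) i
    · simpa using hB
    · simpa using hZ j
  · rintro x (hx | hx)
    · obtain ⟨i, hi⟩ := mem_iUnion.1 (hA hx)
      exact mem_iUnion.2 ⟨i.succ, by simpa using hi⟩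
    · exact mem_iUnion.2 ⟨0, by simpa using hx⟩

lemma DimLt.image {Y : Type*} [MetricSpace X] [TopologicalSpace Y] {e : Y → X} {m : ℕ}
    (he : IsInducing e) {S : Set Y} (h : DimLt m S) : DimLt m (e '' S) := by
  obtain ⟨Z, hZ, hS⟩ := h
  exact ⟨fun i => e '' Z i, fun i => (hZ i).image he, by
    rw [← image_iUnion]; exact image_mono hS⟩

lemma dimLt_of_closed_cover [MetricSpace X] [SecondCountableTopology X] {m : ℕ} {A : Set X}
    {C : ℕ → Set X} (hC : ∀ j, IsClosed (C j)) (hA : A ⊆ ⋃ j, C j) (h : ∀ j, DimLt m (A ∩ C j)) :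
    DimLt m A := by
  choose Z hZ hAZ using h
  refine ⟨fun i => ⋃ j, Z j i ∩ disjointed C j, fun i => ?_, fun x hx => ?_⟩
  · refine zeroDim_of_disjointed_cover hC ?_ fun j => ?_
    · exact iUnion_mono fun j => inter_subset_right.trans (disjointed_subset C j)
    · refine (hZ j i).mono ?_
      rintro x ⟨hx, hxj⟩
      obtain ⟨k, hk⟩ := mem_iUnion.1 hx
      have : k = j := by
        by_contra hne
        exact disjoint_left.1 (disjoint_disjointed C hne) hk.2 hxj
      exact this ▸ hk.1
  · have hx' := hA hx
    rw [← iUnion_disjointed] at hx'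
    obtain ⟨j, hj⟩ := mem_iUnion.1 hx'
    obtain ⟨i, hi⟩ := mem_iUnion.1 (hAZ j ⟨hx, disjointed_subset C j hj⟩)
    exact mem_iUnion.2 ⟨i, mem_iUnion.2 ⟨j, hi, hj⟩⟩

lemma ZeroDim.exists_disjoint_small_cover [MetricSpace X] [SecondCountableTopology X] {Z : Set X}
    (h : ZeroDim Z) {ε : ℝ} (hε : 0 < ε) :
    ∃ W : ℕ → Set X, (∀ j, IsOpen (W j)) ∧ Pairwise (Function.onFun Disjoint W) ∧
      Z ⊆ ⋃ j, W j ∧ ∀ j, ∀ x ∈ W j, ∀ y ∈ W j, dist x y < ε := by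
  obtain ⟨W, h1, h2, h3, h4⟩ := h.exists_disjoint_refinement (fun x => ball x (ε / 2))
    (fun x _ => ⟨isOpen_ball, mem_ball_self (by positivity)⟩)
  refine ⟨W, h1, h2, h3, fun j x hx y hy => ?_⟩
  rcases h4 j with h0 | ⟨z, -, hz⟩
  · simp [h0] at hx
  · have hx' := mem_ball.1 (hz hx)
    have hy' := mem_ball'.1 (hz hy)
    linarith [dist_triangle x z y]

lemma ZeroDim.exists_isGδ_superset [MetricSpace X] [SecondCountableTopology X] {Z : Set X}
    (h : ZeroDim Z) : ∃ G, IsGδ G ∧ Z ⊆ G ∧ ZeroDim G := by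
  choose W hWo hWd hWc hWs using fun k : ℕ =>
    h.exists_disjoint_small_cover (ε := 1 / ((k : ℝ) + 1)) (by positivity)
  refine ⟨⋂ k, ⋃ j, W k j, IsGδ.iInter_of_isOpen fun k => isOpen_iUnion (hWo k),
    subset_iInter hWc, ?_⟩
  intro x hx U hU hxU
  obtain ⟨ε, hε, hεU⟩ := Metric.isOpen_iff.1 hU x hxU
  obtain ⟨k, hk⟩ := exists_nat_one_div_lt hε
  obtain ⟨j, hj⟩ := mem_iUnion.1 (mem_iInter.1 hx k)
  refine ⟨W k j, hWo k j, hj, fun y hy => hεU ((hWs k j y hy x hj).trans hk), ?_⟩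
  rw [disjoint_left]
  intro z hz hzG
  rw [(hWo k j).frontier_eq] at hz
  obtain ⟨i, hi⟩ := mem_iUnion.1 (mem_iInter.1 hzG k)
  obtain ⟨w, hw, hw'⟩ := mem_closure_iff.1 hz.1 _ (hWo k i) hi
  have hne : i ≠ j := by
    rintro rfl
    exact hz.2 hi
  exact disjoint_left.1 (hWd k hne) hw hw'

lemma DimLt.exists_isGδ_superset [MetricSpace X] [SecondCountableTopology X] {m : ℕ} {A : Set X}
    (h : DimLt m A) : ∃ G, IsGδ G ∧ A ⊆ G ∧ DimLt m G := by
  obtain ⟨Z, hZ, hA⟩ := h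
  choose G hG hZG hGz using fun i => (hZ i).exists_isGδ_superset
  exact ⟨⋃ i, G i, IsGδ.iUnion hG, hA.trans (iUnion_mono hZG), G, hGz, subset_rfl⟩

universe u v

lemma indBelow_of_dimLt {X : Type v} [TopologicalSpace X] (m : ℕ) :
    ∀ (Y : Type u) [TopologicalSpace Y] (e : Y → X), IsInducing e → DimLt m (range e) →
      indBelow m Y := by
  induction m with
  | zero =>
    intro Y _ e _ h
    rw [dimLt_zero_iff] at h
    exact range_eq_empty_iff.1 h
  | succ m ih =>
    rintro Y _ e he ⟨Z, hZ, hY⟩ x U hU hxU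
    obtain ⟨U', hU', rfl⟩ := he.isOpen_iff.1 hU
    obtain ⟨i, hi⟩ := mem_iUnion.1 (hY (mem_range_self x))
    obtain ⟨V, h1, h2, h3, h4⟩ := hZ i (e x) hi U' hU' hxU
    refine ⟨e ⁻¹' V, h1.preimage he.continuous, h2, preimage_mono h3, ?_⟩
    refine ih _ (fun z => e z.1) (he.comp IsInducing.subtypeVal) ⟨fun j => Z (i.succAbove j),
      fun j => hZ _, ?_⟩
    rintro _ ⟨z, rfl⟩
    obtain ⟨k, hk⟩ := mem_iUnion.1 (hY (mem_range_self z.1))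
    have hki : k ≠ i := by
      rintro rfl
      exact disjoint_left.1 h4 (he.continuous.frontier_preimage_subset V z.2) hk
    obtain ⟨j, rfl⟩ := Fin.exists_succAbove_eq hki
    exact mem_iUnion.2 ⟨j, hk⟩

lemma dimLt_univ_of_indBelow (m : ℕ) :
    ∀ (Y : Type u) [MetricSpace Y] [SecondCountableTopology Y], indBelow m Y →
      DimLt m (univ : Set Y) := by
  induction m with
  | zero =>
    intro Y _ _ h
    have : IsEmpty Y := h
    rw [dimLt_zero_iff]
    exact univ_eq_empty_iff.2 this
  | succ m ih =>
    intro Y _ _ h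
    have h' : ∀ (x : Y) (U : Set Y), IsOpen U → x ∈ U → ∃ V : Set Y, IsOpen V ∧ x ∈ V ∧ V ⊆ U ∧
        indBelow m ↥(frontier V) := h
    let 𝓥 : Set (Set Y) := {V | IsOpen V ∧ indBelow m ↥(frontier V)}
    have hb : IsTopologicalBasis 𝓥 := isTopologicalBasis_of_isOpen_of_nhds (fun V hV => hV.1)
      fun x U hx hU => by
        obtain ⟨V, h1, h2, h3, h4⟩ := h' x U hU hx
        exact ⟨V, ⟨h1, h4⟩, h2, h3⟩
    obtain ⟨𝓦, h𝓦, hc, h𝓦b⟩ := hb.exists_countable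
    have hd : ∀ V ∈ 𝓦, DimLt m (frontier V) := by
      intro V hV
      have := (ih ↥(frontier V) (h𝓦 hV).2).image IsInducing.subtypeVal
      simpa using this
    have hz : ZeroDim (⋂ V ∈ 𝓦, (frontier V)ᶜ) := by
      intro x hx U hU hxU
      obtain ⟨V, hV, hxV, hVU⟩ := h𝓦b.exists_subset_of_mem_open hxU hU
      refine ⟨V, (h𝓦 hV).1, hxV, hVU, disjoint_left.2 fun z hz hz' => ?_⟩
      exact mem_iInter₂.1 hz' V hV hz
    have hu : DimLt m (⋃ V ∈ 𝓦, frontier V) := by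
      rcases 𝓦.eq_empty_or_nonempty with rfl | hne
      · simpa using (dimLt_zero_iff.2 rfl : DimLt 0 (∅ : Set Y)).of_le (Nat.zero_le m)
      · obtain ⟨g, rfl⟩ := hc.exists_eq_range hne
        refine dimLt_of_closed_cover (C := fun j => frontier (g j)) (fun j => isClosed_frontier)
          (by simp) fun j => (hd _ (mem_range_self j)).mono inter_subset_right
    refine (hu.union_zeroDim hz).mono fun x _ => ?_
    by_cases hx : x ∈ ⋃ V ∈ 𝓦, frontier V
    · exact Or.inl hx
    · refine Or.inr ?_
      simpa using hx

variable {X : Type u} [MetricSpace X] [SecondCountableTopology X]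

lemma indBelow_iff_dimLt {m : ℕ} {A : Set X} : indBelow m A ↔ DimLt m A := by
  constructor
  · intro h
    simpa using (dimLt_univ_of_indBelow m A h).image IsInducing.subtypeVal
  · intro h
    exact indBelow_of_dimLt m A Subtype.val IsInducing.subtypeVal (by simpa using h)

lemma tdim_le_of_dimLt {m : ℕ} {A : Set X} (h : DimLt m A) : tdim A ≤ (m : EReal) - 1 :=
  sInf_le ⟨m, indBelow_iff_dimLt.2 h, rfl⟩

lemma natCast_sub_one_le_iff {m k : ℕ} : (m : EReal) - 1 ≤ (k : EReal) - 1 ↔ m ≤ k := by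
  have h : ∀ j : ℕ, (j : EReal) - 1 = (((j : ℝ) - 1 : ℝ) : EReal) := fun j => by
    rw [EReal.coe_sub]; rfl
  rw [h, h, EReal.coe_le_coe_iff]
  simp

lemma tdim_eq_top_or (A : Set X) :
    (tdim A = ⊤ ∧ ∀ m, ¬ DimLt m A) ∨
      ∃ m : ℕ, tdim A = (m : EReal) - 1 ∧ ∀ k, DimLt k A ↔ m ≤ k := by
  classical
  by_cases h : ∃ m, DimLt m A
  · right
    refine ⟨Nat.find h, ?_, fun k => ⟨fun hk => Nat.find_min' h hk,
      fun hk => (Nat.find_spec h).of_le hk⟩⟩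
    apply le_antisymm (tdim_le_of_dimLt (Nat.find_spec h))
    apply le_sInf
    rintro _ ⟨k, hk, rfl⟩
    exact natCast_sub_one_le_iff.2 (Nat.find_min' h (indBelow_iff_dimLt.1 hk))
  · left
    push Not at h
    refine ⟨?_, h⟩
    rw [tdim, indDim, sInf_eq_top]
    rintro _ ⟨k, hk, rfl⟩
    exact absurd (indBelow_iff_dimLt.1 hk) (h k)

lemma tdim_le_natCast_sub_one_iff {m : ℕ} {A : Set X} : tdim A ≤ (m : EReal) - 1 ↔ DimLt m A := by
  refine ⟨fun h => ?_, tdim_le_of_dimLt⟩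
  rcases tdim_eq_top_or A with ⟨h1, -⟩ | ⟨k, h1, h2⟩
  · rw [h1, top_le_iff] at h
    exact absurd h (by
      rw [show (m : EReal) - 1 = (((m : ℝ) - 1 : ℝ) : EReal) by rw [EReal.coe_sub]; rfl]
      exact EReal.coe_ne_top _)
  · rw [h1] at h
    exact (h2 m).2 (natCast_sub_one_le_iff.1 h)

end DimLt

section DimensionFunctions

variable {X : Type*} [MetricSpace X]

/-- The properties shared by the topological, Hausdorff and packing dimensions. -/
structure IsDimension (dim : Set X → EReal) : Prop where
  empty : dim ∅ = -1
  nonneg : ∀ A : Set X, A.Nonempty → 0 ≤ dim A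
  mono : ∀ A B : Set X, A ⊆ B → dim A ≤ dim B
  closed_cover : ∀ (A : Set X) (C : ℕ → Set X) (c : EReal), (∀ j, IsClosed (C j)) →
    A ⊆ ⋃ j, C j → (∀ j, dim (A ∩ C j) ≤ c) → dim A ≤ c
  singleton : ∀ x, dim {x} ≤ 0

lemma isDimension_tdim [SecondCountableTopology X] : IsDimension (tdim : Set X → EReal) where
  empty := by
    apply le_antisymm
    · simpa using tdim_le_of_dimLt (dimLt_zero_iff.2 (rfl : (∅ : Set X) = ∅))
    · rcases tdim_eq_top_or (∅ : Set X) with ⟨h, -⟩ | ⟨m, h, -⟩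
      · simp [h]
      · rw [h]
        simpa using natCast_sub_one_le_iff.2 (Nat.zero_le m)
  nonneg A hA := by
    rcases tdim_eq_top_or A with ⟨h, -⟩ | ⟨m, h, hm⟩
    · simp [h]
    · rw [h]
      have h0 : 1 ≤ m := by
        by_contra h0
        obtain rfl : m = 0 := by omega
        exact hA.ne_empty (dimLt_zero_iff.1 ((hm 0).2 le_rfl))
      have := natCast_sub_one_le_iff.2 h0
      rwa [Nat.cast_one, show (1 : EReal) - 1 = 0 from by
        rw [show (1 : EReal) = ((1 : ℝ) : EReal) from rfl, ← EReal.coe_sub]; simp] at this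
  mono A B hAB := by
    rcases tdim_eq_top_or B with ⟨h, -⟩ | ⟨m, h, hm⟩
    · simp [h]
    · rw [h, tdim_le_natCast_sub_one_iff]
      exact ((hm m).2 le_rfl).mono hAB
  closed_cover A C c hC hA h := by
    by_contra! hlt
    rcases tdim_eq_top_or A with ⟨h1, h2⟩ | ⟨m, h1, h2⟩
    · rw [h1] at hlt
      obtain ⟨r, hr, -⟩ := EReal.lt_iff_exists_real_btwn.1 hlt
      obtain ⟨k, hk⟩ := exists_nat_ge r
      refine h2 (k + 1) (dimLt_of_closed_cover hC hA fun j => ?_)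
      rw [← tdim_le_natCast_sub_one_iff]
      refine (h j).trans (hr.le.trans ?_)
      rw [show ((k + 1 : ℕ) : EReal) - 1 = ((k : ℝ) : EReal) from by
        rw [show (((k + 1 : ℕ)) : EReal) = (((k : ℝ) + 1 : ℝ) : EReal) from by
          push_cast; rfl, show (1 : EReal) = ((1 : ℝ) : EReal) from rfl, ← EReal.coe_sub]
        simp]
      exact_mod_cast hk
    · rw [h1] at hlt
      rcases m with _ | m
      · have h3 : tdim (A ∩ C 0) < ((0 : ℕ) : EReal) - 1 := (h 0).trans_lt hlt
        rcases tdim_eq_top_or (A ∩ C 0) with ⟨h4, -⟩ | ⟨k, h4, -⟩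
        · simp [h4] at h3
        · rw [h4] at h3
          exact absurd (natCast_sub_one_le_iff.2 (Nat.zero_le k)) h3.not_ge
      · have h3 : ¬ DimLt m A := fun h3 => by
          have := (h2 m).1 h3
          omega
        apply h3
        refine dimLt_of_closed_cover hC hA fun j => ?_
        rcases tdim_eq_top_or (A ∩ C j) with ⟨h4, -⟩ | ⟨k, h4, h5⟩
        · exact absurd ((h j).trans_lt hlt) (by simp [h4])
        · have h6 := (h j).trans_lt hlt
          rw [h4] at h6
          rw [h5]
          by_contra! h7
          exact h6.not_ge (natCast_sub_one_le_iff.2 h7)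
  singleton x := by
    have := tdim_le_of_dimLt (zeroDim_singleton x).dimLt_one
    rwa [Nat.cast_one, show (1 : EReal) - 1 = 0 from by
        rw [show (1 : EReal) = ((1 : ℝ) : EReal) from rfl, ← EReal.coe_sub]; simp] at this

lemma neg_one_le_ennreal (a : ℝ≥0∞) : (-1 : EReal) ≤ (a : EReal) :=
  le_trans (by rw [EReal.neg_le, neg_zero]; exact zero_le_one) (EReal.coe_ennreal_nonneg a)

lemma isDimension_hdim : IsDimension (hdim : Set X → EReal) where
  empty := by simp [hdim]
  nonneg A hA := by
    rw [hdim, if_neg hA.ne_empty]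
    exact EReal.coe_ennreal_nonneg _
  mono A B hAB := by
    by_cases hA : A = ∅
    · by_cases hB : B = ∅
      · rw [hA, hB]
      · rw [hdim, hdim, if_pos hA, if_neg hB]
        exact neg_one_le_ennreal _
    · have hB : B ≠ ∅ := ((nonempty_iff_ne_empty.2 hA).mono hAB).ne_empty
      rw [hdim, hdim, if_neg hA, if_neg hB]
      exact EReal.coe_ennreal_le_coe_ennreal_iff.2 (dimH_mono hAB)
  closed_cover A C c _ hA h := by
    have hAC : A = ⋃ j, A ∩ C j := by rw [← inter_iUnion, inter_eq_left.2 hA]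
    by_cases hA0 : A = ∅
    · have := h 0
      simp only [hA0, empty_inter] at this
      rwa [hA0]
    · have hc : 0 ≤ c := by
        obtain ⟨x, hx⟩ := nonempty_iff_ne_empty.2 hA0
        obtain ⟨j, hj⟩ := mem_iUnion.1 (hA hx)
        have := h j
        rw [hdim, if_neg (Set.Nonempty.ne_empty (s := A ∩ C j) ⟨x, hx, hj⟩)] at this
        exact (EReal.coe_ennreal_nonneg _).trans this
      lift c to ℝ≥0∞ using hc
      rw [hdim, if_neg hA0, EReal.coe_ennreal_le_coe_ennreal_iff]
      rw [hAC, dimH_iUnion]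
      refine iSup_le fun j => ?_
      by_cases hj : A ∩ C j = ∅
      · rw [hj]; simp
      · have := h j
        rwa [hdim, if_neg hj, EReal.coe_ennreal_le_coe_ennreal_iff] at this
  singleton x := by
    rw [hdim, if_neg (singleton_ne_empty x), dimH_singleton]
    simp

/-! ### Packing measures -/

lemma isPacking_mono {A B : Set X} {δ η : ℝ≥0} {s : Set (X × ℝ≥0)} (h : IsPacking A δ s)
    (hAB : A ⊆ B) (hδ : δ ≤ η) : IsPacking B η s :=
  ⟨h.1, fun p hp => ⟨hAB (h.2.1 p hp).1, (h.2.1 p hp).2.trans hδ⟩, h.2.2⟩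

lemma packPre_mono {h : ℝ≥0 → ℝ≥0} {A B : Set X} {δ η : ℝ≥0} (hAB : A ⊆ B) (hδ : δ ≤ η) :
    packPre h A δ ≤ packPre h B η :=
  iSup₂_le fun s hs => le_iSup₂_of_le s (isPacking_mono hs hAB hδ) le_rfl

lemma packPre0_mono {h : ℝ≥0 → ℝ≥0} {A B : Set X} (hAB : A ⊆ B) :
    packPre0 h A ≤ packPre0 h B :=
  iInf₂_mono fun _ _ => packPre_mono hAB le_rfl

lemma packPre0_empty (h : ℝ≥0 → ℝ≥0) : packPre0 h (∅ : Set X) = 0 := by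
  refine le_antisymm (iInf₂_le_of_le 1 one_pos (iSup₂_le fun s hs => ?_)) zero_le
  have : s = ∅ := eq_empty_of_forall_notMem fun p hp => (hs.2.1 p hp).1
  subst this
  simp

lemma packMeasure_mono {h : ℝ≥0 → ℝ≥0} {A B : Set X} (hAB : A ⊆ B) :
    packMeasure h A ≤ packMeasure h B :=
  le_iInf₂ fun c hc => iInf₂_le_of_le (fun i => A ∩ c i)
    (by rw [← inter_iUnion, ← hc, inter_eq_left.2 hAB])
    (ENNReal.tsum_le_tsum fun _ => packPre0_mono inter_subset_right)

lemma packMeasure_le_packPre0 (h : ℝ≥0 → ℝ≥0) (A : Set X) : packMeasure h A ≤ packPre0 h A := by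
  refine iInf₂_le_of_le (fun i => if i = 0 then A else ∅) ?_ ?_
  · ext x
    simp
  · rw [tsum_eq_single 0 (fun i hi => by simp [hi, packPre0_empty])]
    simp

lemma packMeasure_iUnion_eq_zero {h : ℝ≥0 → ℝ≥0} {A : ℕ → Set X}
    (hA : ∀ j, packMeasure h (A j) = 0) : packMeasure h (⋃ j, A j) = 0 := by
  refine le_antisymm (le_of_forall_pos_le_add fun ε hε => ?_) zero_le
  obtain ⟨δ, hδ, hδs⟩ := ENNReal.exists_pos_sum_of_countable' hε.ne' ℕ
  have hex : ∀ j, ∃ c : ℕ → Set X, A j = ⋃ i, c i ∧ ∑' i, packPre0 h (c i) < δ j := by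
    intro j
    have := (hA j).trans_lt (hδ j)
    rw [packMeasure] at this
    simp only [iInf_lt_iff] at this
    obtain ⟨c, hc, hlt⟩ := this
    exact ⟨c, hc, hlt⟩
  choose c hc hlt using hex
  rw [zero_add]
  refine iInf₂_le_of_le (fun k => c k.unpair.1 k.unpair.2) ?_ ?_
  · ext x
    simp only [mem_iUnion, hc]
    constructor
    · rintro ⟨j, i, hx⟩
      exact ⟨Nat.pair j i, by simpa using hx⟩
    · rintro ⟨k, hx⟩
      exact ⟨_, _, hx⟩
  · have e : ∑' k : ℕ, packPre0 h (c k.unpair.1 k.unpair.2)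
        = ∑' p : ℕ × ℕ, packPre0 h (c p.1 p.2) :=
      Nat.pairEquiv.symm.tsum_eq (fun p : ℕ × ℕ => packPre0 h (c p.1 p.2))
    rw [e, ENNReal.tsum_prod']
    exact (ENNReal.tsum_le_tsum fun j => (hlt j).le).trans hδs.le

lemma packPre_rpow_le (A : Set X) {s t : ℝ} (ht : 0 ≤ t) (hst : t < s) (δ : ℝ≥0) :
    packPre (fun r => r ^ s) A δ ≤ ((δ ^ (s - t) : ℝ≥0) : ℝ≥0∞) * packPre (fun r => r ^ t) A δ := by
  refine iSup₂_le fun S hS => ?_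
  refine le_trans ?_ (mul_le_mul_right (le_iSup₂_of_le S hS le_rfl) _)
  rw [← ENNReal.tsum_mul_left]
  refine ENNReal.tsum_le_tsum fun p => ?_
  rw [← ENNReal.coe_mul, ENNReal.coe_le_coe]
  rcases eq_or_ne p.1.2 0 with h0 | h0
  · simp [h0, NNReal.zero_rpow (ht.trans_lt hst).ne']
  · have : p.1.2 ^ s = p.1.2 ^ (s - t) * p.1.2 ^ t := by
      rw [← NNReal.rpow_add h0]; simp
    change p.1.2 ^ s ≤ _
    rw [this]
    exact mul_le_mul_left (NNReal.rpow_le_rpow (hS.2.1 p.1 p.2).2 (by linarith)) _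

lemma packPre0_rpow_eq_zero {A : Set X} {s t : ℝ} (ht : 0 ≤ t) (hst : t < s)
    (h : packPre0 (fun r => r ^ t) A < ∞) : packPre0 (fun r => r ^ s) A = 0 := by
  rw [packPre0] at h
  simp only [iInf_lt_iff] at h
  obtain ⟨δ₀, hδ₀, hlt⟩ := h
  set M := packPre (fun r => r ^ t) A δ₀
  have hle : ∀ δ : ℝ≥0, 0 < δ → δ ≤ δ₀ →
      packPre0 (fun r => r ^ s) A ≤ ((δ ^ (s - t) : ℝ≥0) : ℝ≥0∞) * M := fun δ hδ hδ' =>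
    (iInf₂_le δ hδ).trans ((packPre_rpow_le A ht hst δ).trans
      (mul_le_mul_right (packPre_mono subset_rfl hδ') _))
  have hlim : Tendsto (fun δ : ℝ≥0 => ((δ ^ (s - t) : ℝ≥0) : ℝ≥0∞) * M) (𝓝[>] 0) (𝓝 0) := by
    have h1 : Tendsto (fun δ : ℝ≥0 => δ ^ (s - t)) (𝓝 0) (𝓝 0) := by
      have := (NNReal.continuousAt_rpow_const (x := 0) (y := s - t)
        (Or.inr (by linarith))).tendsto
      rwa [NNReal.zero_rpow (by linarith)] at this
    have h2 := ENNReal.Tendsto.mul_const (b := M) (ENNReal.tendsto_coe.2 h1) (Or.inr hlt.ne)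
    simp only [ENNReal.coe_zero, zero_mul] at h2
    exact h2.mono_left nhdsWithin_le_nhds
  refine le_antisymm (ge_of_tendsto hlim ?_) zero_le
  filter_upwards [Ioc_mem_nhdsGT hδ₀] with δ hδ using hle δ hδ.1 hδ.2

lemma packMeasure_rpow_eq_zero {A : Set X} {s t : ℝ} (ht : 0 ≤ t) (hst : t < s)
    (h : packMeasure (fun r => r ^ t) A ≠ ∞) : packMeasure (fun r => r ^ s) A = 0 := by
  have h' := lt_top_iff_ne_top.2 h
  rw [packMeasure] at h'
  simp only [iInf_lt_iff] at h'
  obtain ⟨c, hc, hlt⟩ := h'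
  refine le_antisymm (iInf₂_le_of_le c hc ?_) zero_le
  refine le_of_eq (ENNReal.tsum_eq_zero.2 fun i => packPre0_rpow_eq_zero ht hst ?_)
  exact (ENNReal.le_tsum i).trans_lt hlt

lemma packMeasure_singleton (x : X) (s : ℝ≥0) :
    packMeasure (fun r => r ^ (s : ℝ)) ({x} : Set X) ≠ ∞ := by
  refine ((packMeasure_le_packPre0 _ _).trans
    (iInf₂_le_of_le 1 one_pos (iSup₂_le fun S hS => ?_))).trans_lt ENNReal.one_lt_top |>.ne
  have hsub : S.Subsingleton := by
    intro p hp q hq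
    by_contra hpq
    have h1 : p.1 = x := (hS.2.1 p hp).1
    have h2 : q.1 = x := (hS.2.1 q hq).1
    have h3 := hS.2.2 hp hq hpq
    exact disjoint_left.1 h3 (mem_closedBall_self p.2.2)
      (by rw [h1, ← h2]; exact mem_closedBall_self q.2.2)
  rcases hsub.eq_empty_or_singleton with rfl | ⟨p, rfl⟩
  · simp
  · rw [tsum_singleton p (fun p : X × ℝ≥0 => ((p.2 ^ (s : ℝ) : ℝ≥0) : ℝ≥0∞))]
    exact_mod_cast NNReal.rpow_le_one (hS.2.1 p rfl).2 s.2

lemma pdim_nonneg {A : Set X} (hA : A.Nonempty) : 0 ≤ pdim A := by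
  rw [pdim, if_neg hA.ne_empty]
  exact le_max_left _ _

lemma le_pdim {A : Set X} (hA : A.Nonempty) {s : ℝ≥0}
    (h : packMeasure (fun r => r ^ (s : ℝ)) A = ∞) : ((s : ℝ) : EReal) ≤ pdim A := by
  rw [pdim, if_neg hA.ne_empty]
  exact le_max_of_le_right (le_iSup₂_of_le s h le_rfl)

lemma packMeasure_ne_top_of_pdim_lt {A : Set X} {s : ℝ≥0} (h : pdim A < ((s : ℝ) : EReal)) :
    packMeasure (fun r => r ^ (s : ℝ)) A ≠ ∞ := by
  rcases A.eq_empty_or_nonempty with rfl | hA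
  · exact ((packMeasure_le_packPre0 _ _).trans_lt (by rw [packPre0_empty]; simp)).ne
  · exact fun h' => h.not_ge (le_pdim hA h')

lemma packMeasure_eq_top_of_lt_pdim {A : Set X} {s : ℝ≥0} (h : ((s : ℝ) : EReal) < pdim A) :
    packMeasure (fun r => r ^ (s : ℝ)) A = ∞ := by
  have hs : (0 : EReal) ≤ ((s : ℝ) : EReal) := by exact_mod_cast s.2
  have hA : A ≠ ∅ := by
    rintro rfl
    rw [pdim, if_pos rfl] at h
    exact absurd (hs.trans_lt h) (by rw [not_lt, EReal.neg_le, neg_zero]; exact zero_le_one)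
  rw [pdim, if_neg hA, lt_max_iff] at h
  rcases h with h | h
  · exact absurd h hs.not_gt
  · simp only [lt_iSup_iff] at h
    obtain ⟨t, ht, hst⟩ := h
    by_contra hne
    have h1 : (s : ℝ) < t := by exact_mod_cast hst
    rw [packMeasure_rpow_eq_zero s.2 h1 hne] at ht
    exact ENNReal.zero_ne_top ht

lemma isDimension_pdim : IsDimension (pdim : Set X → EReal) where
  empty := by simp [pdim]
  nonneg A hA := pdim_nonneg hA
  mono A B hAB := by
    by_cases hA : A = ∅
    · by_cases hB : B = ∅
      · rw [hA, hB]
      · rw [pdim, if_pos hA]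
        exact le_trans (by rw [EReal.neg_le, neg_zero]; exact zero_le_one)
          (pdim_nonneg (nonempty_iff_ne_empty.2 hB))
    · have hB : B ≠ ∅ := ((nonempty_iff_ne_empty.2 hA).mono hAB).ne_empty
      rw [pdim, pdim, if_neg hA, if_neg hB]
      refine max_le_max le_rfl (iSup₂_le fun s hs => le_iSup₂_of_le s ?_ le_rfl)
      exact top_unique (hs ▸ packMeasure_mono hAB)
  closed_cover A C c _ hA h := by
    have hAC : A = ⋃ j, A ∩ C j := by rw [← inter_iUnion, inter_eq_left.2 hA]
    by_cases hA0 : A = ∅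
    · have := h 0
      simp only [hA0, empty_inter] at this
      rwa [hA0]
    · have hc : 0 ≤ c := by
        obtain ⟨x, hx⟩ := nonempty_iff_ne_empty.2 hA0
        obtain ⟨j, hj⟩ := mem_iUnion.1 (hA hx)
        exact (pdim_nonneg (A := A ∩ C j) ⟨x, hx, hj⟩).trans (h j)
      by_contra! hlt
      obtain ⟨s, hcs, hs⟩ := EReal.lt_iff_exists_real_btwn.1 hlt
      obtain ⟨t, hct, hts⟩ := EReal.lt_iff_exists_real_btwn.1 hcs
      have ht0 : 0 ≤ t := by exact_mod_cast hc.trans hct.le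
      have hts' : t < s := by exact_mod_cast hts
      lift t to ℝ≥0 using ht0
      lift s to ℝ≥0 using (t.2.trans hts'.le)
      have h1 : packMeasure (fun r => r ^ (s : ℝ)) A = 0 := by
        rw [hAC]
        refine packMeasure_iUnion_eq_zero fun j => packMeasure_rpow_eq_zero t.2 hts' ?_
        exact packMeasure_ne_top_of_pdim_lt ((h j).trans_lt hct)
      rw [packMeasure_eq_top_of_lt_pdim hs] at h1
      exact ENNReal.top_ne_zero h1
  singleton x := by
    by_contra! hlt
    obtain ⟨s, h0s, hs⟩ := EReal.lt_iff_exists_real_btwn.1 hlt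
    have h0 : 0 < s := by exact_mod_cast h0s
    lift s to ℝ≥0 using h0.le
    exact packMeasure_singleton x s (packMeasure_eq_top_of_lt_pdim hs)

end DimensionFunctions

section Perturbation

variable {K : Type*} [TopologicalSpace K] [NormalSpace K]

lemma exists_perturbation_real {ι : Type*} [Finite ι] {L : ι → Set K} (hL : ∀ j, IsClosed (L j))
    (hd : Pairwise (Function.onFun Disjoint L)) (f : C(K, ℝ)) (t : ι → C(K, ℝ)) {ε : ℝ}
    (hε : 0 ≤ ε) (ht : ∀ j, ∀ x ∈ L j, |t j x - f x| ≤ ε) :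
    ∃ h : C(K, ℝ), (∀ j, ∀ x ∈ L j, h x = t j x) ∧ ∀ x, |h x - f x| ≤ ε := by
  classical
  have huniq : ∀ i j x, x ∈ L i → x ∈ L j → i = j := fun i j x hi hj => by
    by_contra hne
    exact Set.disjoint_left.1 (hd hne) hi hj
  let G : K → ℝ := fun x => if hx : ∃ j, x ∈ L j then t hx.choose x - f x else 0
  have hG : ∀ j, ∀ x ∈ L j, G x = t j x - f x := fun j x hx => by
    have hx' : ∃ j, x ∈ L j := ⟨j, hx⟩
    simp only [G, dif_pos hx']
    rw [huniq _ _ x hx'.choose_spec hx]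
  have hGc : ContinuousOn G (⋃ j, L j) := by
    refine (locallyFinite_of_finite L).continuousOn_iUnion hL fun j => ?_
    refine ContinuousOn.congr (f := fun x => t j x - f x) ?_ (hG j)
    exact ((t j).continuous.sub f.continuous).continuousOn
  have hS : IsClosed (⋃ j, L j) := isClosed_iUnion_of_finite hL
  obtain ⟨g, hg1, hg2⟩ := ContinuousMap.exists_restrict_eq_forall_mem_of_closed
    (s := ⋃ j, L j) ⟨_, hGc.domRestrict⟩ (t := Icc (-ε) ε) (by
      rintro ⟨x, hx⟩
      obtain ⟨j, hj⟩ := mem_iUnion.1 hx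
      simp only [ContinuousMap.coe_mk, domRestrict_apply]
      rw [hG j x hj]
      exact abs_le.1 (ht j x hj)) ⟨0, by simp [hε]⟩ hS
  refine ⟨f + g, fun j x hx => ?_, fun x => ?_⟩
  · have := DFunLike.congr_fun hg2 ⟨x, mem_iUnion.2 ⟨j, hx⟩⟩
    simp only [ContinuousMap.restrict_apply, ContinuousMap.coe_mk, domRestrict_apply] at this
    rw [ContinuousMap.add_apply, this, hG j x hx]
    ring
  · rw [ContinuousMap.add_apply, add_sub_cancel_left]
    exact abs_le.2 (hg1 x)

/-- The `i`-th coordinate of a continuous map. -/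
def coordMap {n : ℕ} (f : C(K, Fin n → ℝ)) (i : Fin n) : C(K, ℝ) :=
  ⟨fun x => f x i, (continuous_apply i).comp f.continuous⟩

lemma exists_perturbation [CompactSpace K] {n : ℕ} {ι : Type*} [Finite ι]
    {L : Fin n → ι → Set K}
    (hL : ∀ i j, IsClosed (L i j)) (hd : ∀ i, Pairwise (Function.onFun Disjoint (L i)))
    (f : C(K, Fin n → ℝ)) (t : Fin n → ι → C(K, ℝ)) {ε : ℝ}
    (hε : 0 ≤ ε) (ht : ∀ i j, ∀ x ∈ L i j, |t i j x - f x i| ≤ ε) :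
    ∃ h : C(K, Fin n → ℝ), (∀ i j, ∀ x ∈ L i j, h x i = t i j x) ∧ dist h f ≤ ε := by
  choose h h1 h2 using fun i => exists_perturbation_real (hL i) (hd i) (coordMap f i) (t i) hε (ht i)
  refine ⟨⟨fun x i => h i x, continuous_pi fun i => (h i).continuous⟩, h1, ?_⟩
  rw [ContinuousMap.dist_le hε]
  intro x
  rw [dist_pi_le_iff hε]
  intro i
  rw [Real.dist_eq]
  exact h2 i x

end Perturbation

section SmallCovers

variable {K : Type*} [MetricSpace K]

/-- `C` is covered by `m` disjoint families of open sets of diameter less than `ε`. -/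
def SmallCover (m : ℕ) (ε : ℝ) (C : Set K) : Prop :=
  ∃ W : Fin m → ℕ → Set K, (∀ i j, IsOpen (W i j)) ∧
    (∀ i, Pairwise (Function.onFun Disjoint (W i))) ∧ C ⊆ ⋃ i, ⋃ j, W i j ∧
    ∀ i j, ∀ x ∈ W i j, ∀ y ∈ W i j, dist x y < ε

lemma DimLt.smallCover [SecondCountableTopology K] {m : ℕ} {C : Set K} (h : DimLt m C) {ε : ℝ}
    (hε : 0 < ε) : SmallCover m ε C := by
  obtain ⟨Z, hZ, hC⟩ := h
  choose W h1 h2 h3 h4 using fun i => (hZ i).exists_disjoint_small_cover hε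
  exact ⟨W, h1, h2, hC.trans (iUnion_mono h3), h4⟩

/-- On a compact space the families may be taken finite and closed. -/
lemma SmallCover.exists_closed [CompactSpace K] {m : ℕ} {ε : ℝ} {C : Set K}
    (h : SmallCover m ε C) (hC : IsClosed C) :
    ∃ (N : ℕ) (E : Fin m → Fin N → Set K), (∀ i j, IsClosed (E i j)) ∧
    (∀ i, Pairwise (Function.onFun Disjoint (E i))) ∧ C ⊆ ⋃ i, ⋃ j, E i j ∧
    ∀ i j, ∀ x ∈ E i j, ∀ y ∈ E i j, dist x y < ε := by
  obtain ⟨W, h1, h2, h3, h4⟩ := h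
  have h3' : C ⊆ ⋃ p : Fin m × ℕ, W p.1 p.2 := by
    intro x hx
    have := h3 hx
    simp only [mem_iUnion] at this ⊢
    obtain ⟨i, j, h⟩ := this
    exact ⟨(i, j), h⟩
  obtain ⟨s, hs⟩ := hC.isCompact.elim_finite_subcover _ (fun p : Fin m × ℕ => h1 p.1 p.2) h3'
  obtain ⟨N, hN⟩ : ∃ N, ∀ p ∈ s, p.2 < N := by
    refine ⟨s.sup Prod.snd + 1, fun p hp => ?_⟩
    exact Nat.lt_succ_of_le (Finset.le_sup (f := Prod.snd) hp)
  obtain ⟨v, hv1, hv2, hv3⟩ := exists_subset_iUnion_closed_subset (s := C)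
    (u := fun p : Fin m × Fin N => W p.1 p.2) hC (fun p => h1 _ _) (fun x _ => toFinite _) (by
      intro x hx
      obtain ⟨p, hp, hxp⟩ := mem_iUnion₂.1 (hs hx)
      exact mem_iUnion.2 ⟨(p.1, ⟨p.2, hN p hp⟩), hxp⟩)
  refine ⟨N, fun i j => v (i, j), fun i j => hv2 _, fun i j j' hjj' => ?_, ?_, fun i j x hx y hy => ?_⟩
  · exact (h2 i (fun h => hjj' (Fin.ext h))).mono (hv3 (i, j)) (hv3 (i, j'))
  · intro x hx
    obtain ⟨p, hp⟩ := mem_iUnion.1 (hv1 hx)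
    exact mem_iUnion₂.2 ⟨p.1, p.2, hp⟩
  · exact h4 i j x (hv3 _ hx) y (hv3 _ hy)

end SmallCovers

section FiniteFibers

lemma exists_injective_approx {N : ℕ} (b : Fin N → ℝ) {ε : ℝ} (hε : 0 < ε) :
    ∃ c : Fin N → ℝ, Function.Injective c ∧ (∀ j, c j ≠ 0) ∧ ∀ j, |c j - b j| < ε := by
  have hfin : (range (fun p : Fin N × Fin N => (b p.2 - b p.1) / ((p.1 : ℝ) - p.2)) ∪
      range (fun j : Fin N => - b j / ((j : ℝ) + 1))).Finite :=
    (finite_range _).union (finite_range _)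
  have hδ : 0 < ε / (N + 1) := by positivity
  obtain ⟨t, ht, ht'⟩ := (Ioo_infinite hδ).exists_notMem_finite hfin
  rw [mem_union, not_or] at ht'
  refine ⟨fun j => b j + t * (j + 1), fun i j hij => ?_, fun j hj => ?_, fun j => ?_⟩
  · by_contra hne
    have hne' : (i : ℝ) - j ≠ 0 := by
      rw [sub_ne_zero]
      exact fun h => hne (Fin.ext (Nat.cast_injective h))
    refine ht'.1 ⟨(i, j), ?_⟩
    simp only at hij ⊢
    rw [div_eq_iff hne']
    linarith
  · refine ht'.2 ⟨j, ?_⟩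
    simp only at hj ⊢
    rw [div_eq_iff (by positivity)]
    linarith
  · rw [add_sub_cancel_left, abs_of_pos (mul_pos ht.1 (by positivity))]
    have hj : ((j : ℕ) : ℝ) + 1 ≤ N := by exact_mod_cast j.2
    calc t * ((j : ℝ) + 1) ≤ t * N := by
          have := ht.1.le
          gcongr
      _ < ε := by
          have h2 := ht.2
          rw [lt_div_iff₀ (by positivity)] at h2
          have := ht.1
          linarith

variable {K : Type*} [MetricSpace K] [CompactSpace K]

lemma exists_locally_constant_approx {n : ℕ} {C : Set K} (hC : IsClosed C)
    (hS : ∀ ε > 0, SmallCover n ε C) (f : C(K, Fin n → ℝ)) {ε η : ℝ} (hε : 0 < ε) (hη : 0 < η) :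
    ∃ (h : C(K, Fin n → ℝ)) (N : ℕ) (E : Fin n → Fin N → Set K) (c : Fin n → Fin N → ℝ),
      dist h f ≤ ε ∧ C ⊆ ⋃ i, ⋃ j, E i j ∧ (∀ i j, ∀ x ∈ E i j, ∀ y ∈ E i j, dist x y < η) ∧
      (∀ i, Function.Injective (c i)) ∧ (∀ i j, c i j ≠ 0) ∧
      ∀ i j, ∀ x ∈ E i j, h x i = c i j := by
  classical
  obtain ⟨δ, hδ, hfδ⟩ := Metric.uniformContinuous_iff.1
    (CompactSpace.uniformContinuous_of_continuous f.continuous) (ε / 2) (by positivity)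
  obtain ⟨N, E, h1, h2, h3, h4⟩ := (hS (min η δ) (lt_min hη hδ)).exists_closed hC
  let b : Fin n → Fin N → ℝ := fun i j => if h : (E i j).Nonempty then f h.some i else 0
  choose c hc1 hc0 hc2 using fun i => exists_injective_approx (b i) (half_pos hε)
  obtain ⟨h, hh1, hh2⟩ := exists_perturbation h1 h2 f (fun i j => ContinuousMap.const K (c i j))
    hε.le (by
      intro i j x hx
      have hne : (E i j).Nonempty := ⟨x, hx⟩
      have e1 : |b i j - f x i| ≤ ε / 2 := by
        simp only [b, dif_pos hne]
        rw [← Real.dist_eq]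
        exact (dist_le_pi_dist _ _ i).trans
          (hfδ ((h4 i j _ hne.some_mem _ hx).trans_le (min_le_right _ _))).le
      simp only [ContinuousMap.const_apply]
      calc |c i j - f x i| ≤ |c i j - b i j| + |b i j - f x i| := abs_sub_le _ _ _
        _ ≤ ε := by linarith [hc2 i j])
  exact ⟨h, N, E, c, hh2, h3, fun i j x hx y hy => (h4 i j x hx y hy).trans_le (min_le_left _ _),
    hc1, hc0, hh1⟩

lemma dense_fiber_zero_avoids {n : ℕ} {C : Set K} (hC : IsClosed C)
    (hS : ∀ ε > 0, SmallCover n ε C) :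
    Dense {f : C(K, Fin n → ℝ) | f ⁻¹' {0} ∩ C = ∅} := by
  rw [Metric.dense_iff]
  intro f r hr
  obtain ⟨h, N, E, c, h1, h2, -, -, h5, h6⟩ :=
    exists_locally_constant_approx hC hS f (half_pos hr) one_pos
  refine ⟨h, by rw [mem_ball]; linarith, ?_⟩
  rw [mem_ofPred_eq, eq_empty_iff_forall_notMem]
  rintro x ⟨hx0, hxC⟩
  obtain ⟨i, j, hx⟩ := mem_iUnion₂.1 (h2 hxC)
  refine h5 i j ?_
  rw [← h6 i j x hx, show h x = 0 from hx0]
  rfl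

/-- The maps without `n + 1` points of `C` in a single fiber with mutual distances at least `η`. -/
def fewSeparated (n : ℕ) (C : Set K) (η : ℝ) : Set C(K, Fin n → ℝ) :=
  {f | ∀ x : Fin (n + 1) → K, (∀ k, x k ∈ C) → (∀ k l, f (x k) = f (x l)) →
    ∃ k l, k ≠ l ∧ dist (x k) (x l) < η}

lemma isOpen_fewSeparated {n : ℕ} {C : Set K} (hC : IsClosed C) (η : ℝ) :
    IsOpen (fewSeparated n C η) := by
  have h1 : IsClosed {p : C(K, Fin n → ℝ) × (Fin (n + 1) → K) | (∀ k, p.2 k ∈ C) ∧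
      (∀ k l, p.1 (p.2 k) = p.1 (p.2 l)) ∧ ∀ k l, k ≠ l → η ≤ dist (p.2 k) (p.2 l)} := by
    simp only [ofPred_and, ofPred_forall]
    refine IsClosed.inter ?_ (IsClosed.inter ?_ ?_)
    · exact isClosed_iInter fun k => hC.preimage (by fun_prop)
    · exact isClosed_iInter fun k => isClosed_iInter fun l =>
        isClosed_eq (by fun_prop) (by fun_prop)
    · exact isClosed_iInter fun k => isClosed_iInter fun l => isClosed_iInter fun _ =>
        isClosed_le (by fun_prop) (by fun_prop)
  have h2 := isClosedMap_fst_of_compactSpace _ h1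
  rw [← isOpen_compl_iff] at h2
  convert h2 using 1
  ext f
  simp only [fewSeparated, mem_ofPred_eq, mem_compl_iff, mem_image, Prod.exists, exists_and_right,
    exists_eq_right]
  push Not
  rfl

lemma dense_fewSeparated {n : ℕ} {C : Set K} (hC : IsClosed C) (hS : ∀ ε > 0, SmallCover n ε C)
    {η : ℝ} (hη : 0 < η) : Dense (fewSeparated n C η) := by
  rw [Metric.dense_iff]
  intro f r hr
  obtain ⟨h, N, E, c, h1, h2, h3, h4, -, h6⟩ :=
    exists_locally_constant_approx hC hS f (half_pos hr) hη
  refine ⟨h, by rw [mem_ball]; linarith, ?_⟩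
  rw [fewSeparated, mem_ofPred_eq]
  intro x hxC hx
  have : ∀ k, ∃ i j, x k ∈ E i j := fun k => mem_iUnion₂.1 (h2 (hxC k))
  choose i j hij using this
  obtain ⟨k, l, hkl, hikl⟩ := Fintype.exists_ne_map_eq_of_card_lt i (by simp)
  refine ⟨k, l, hkl, ?_⟩
  have hj : j k = j l := by
    apply h4 (i k)
    rw [← h6 _ _ _ (hij k), hx k l, hikl, ← h6 _ _ _ (hij l)]
  refine h3 (i k) (j k) _ (hij k) _ ?_
  rw [hikl, hj]
  exact hij l

lemma eventually_encard_fiber_inter_le {n : ℕ} {C : ℕ → Set K} (hC : ∀ i, IsClosed (C i))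
    (hd : DimLt n (⋃ i, C i)) :
    ∀ᶠ f : C(K, Fin n → ℝ) in residual C(K, Fin n → ℝ),
      ∀ y, (f ⁻¹' {y} ∩ ⋃ i, C i).encard ≤ n := by
  let A : ℕ → Set K := fun k => ⋃ i ∈ Finset.range k, C i
  have hA : ∀ k, IsClosed (A k) := fun k => isClosed_biUnion_finset fun i _ => hC i
  have hAd : ∀ k, DimLt n (A k) := fun k => hd.mono (by
    simp only [A, iUnion_subset_iff]
    exact fun i _ => subset_iUnion C i)
  have key : ∀ᶠ f : C(K, Fin n → ℝ) in residual C(K, Fin n → ℝ),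
      ∀ k m : ℕ, f ∈ fewSeparated n (A k) (1 / ((m : ℝ) + 1)) := by
    rw [eventually_countable_forall]
    intro k
    rw [eventually_countable_forall]
    intro m
    exact residual_of_dense_open (isOpen_fewSeparated (hA k) _)
      (dense_fewSeparated (hA k) (fun ε hε => (hAd k).smallCover hε) (by positivity))
  filter_upwards [key] with f hf y
  by_contra! hlt
  have hlt' : ((n + 1 : ℕ) : ℕ∞) ≤ (f ⁻¹' {y} ∩ ⋃ i, C i).encard := by
    push_cast
    exact Order.add_one_le_of_lt hlt
  obtain ⟨S, hS, hcard⟩ := exists_subset_encard_eq hlt'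
  have hfin : S.Finite := finite_of_encard_eq_coe hcard
  have hcard' : Nat.card S = n + 1 := by
    rw [Nat.card_coe_set_eq, ncard, hcard]; rfl
  have : Finite S := hfin
  let e : Fin (n + 1) ≃ S := (Finite.equivFinOfCardEq hcard').symm
  let x : Fin (n + 1) → K := fun k => e k
  have hxinj : Function.Injective x := Subtype.val_injective.comp e.injective
  have hxS : ∀ k, x k ∈ S := fun k => (e k).2
  choose i hi using fun k => mem_iUnion.1 (hS (hxS k)).2
  have hxA : ∀ k, x k ∈ A (Finset.univ.sup i + 1) := fun k => by
    simp only [A, mem_iUnion]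
    refine ⟨i k, ?_, hi k⟩
    rw [Finset.mem_range]
    exact Nat.lt_succ_of_le (Finset.le_sup (f := i) (Finset.mem_univ k))
  have hpos : ∃ δ : ℝ, 0 < δ ∧ ∀ k l, k ≠ l → δ ≤ dist (x k) (x l) := by
    have h1 : ∀ᶠ δ : ℝ in 𝓝[>] 0, ∀ k l, k ≠ l → δ ≤ dist (x k) (x l) := by
      rw [eventually_all]; intro k
      rw [eventually_all]; intro l
      rw [eventually_imp_distrib_left]; intro hkl
      have : 0 < dist (x k) (x l) := dist_pos.2 fun h => hkl (hxinj h)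
      filter_upwards [Ioo_mem_nhdsGT this] with δ hδ using hδ.2.le
    obtain ⟨δ, h2, h3⟩ := (h1.and self_mem_nhdsWithin).exists
    exact ⟨δ, h3, h2⟩
  obtain ⟨δ, hδ, hδ'⟩ := hpos
  obtain ⟨m, hm⟩ := exists_nat_one_div_lt hδ
  obtain ⟨k, l, hkl, hlt2⟩ := hf (Finset.univ.sup i + 1) m x hxA fun k l => by
    have h1 : f (x k) = y := (hS (hxS k)).1
    have h2 : f (x l) = y := (hS (hxS l)).1
    rw [h1, h2]
  linarith [hδ' k l hkl]

end FiniteFibers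

section GenericSequences

variable {K : Type*} [MetricSpace K]

/-- A hereditary property of sets which may be checked on countable closed covers. -/
structure IsClosedIdeal (P : Set K → Prop) : Prop where
  empty : P ∅
  mono : ∀ A B : Set K, A ⊆ B → P B → P A
  closed_cover : ∀ (A : Set K) (C : ℕ → Set K), (∀ j, IsClosed (C j)) → A ⊆ ⋃ j, C j →
    (∀ j, P (A ∩ C j)) → P A

/-- The smallness properties `P` of sets to which the reduction to fibers applies; for closed sets
they are given by countably many conditions `O k` which are open from above. -/
structure IsSmallness (P : Set K → Prop) (O : ℕ → Set K → Prop) : Prop extends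
    IsClosedIdeal P where
  hull : ∀ A : Set K, P A → ∃ G, IsGδ G ∧ A ⊆ G ∧ P G
  open_upper : ∀ (k : ℕ) (C : Set K), O k C → ∃ U, IsOpen U ∧ C ⊆ U ∧ ∀ C' ⊆ U, O k C'
  iff_of_isClosed : ∀ C : Set K, IsClosed C → (P C ↔ ∀ k, O k C)

/-- `A` satisfies `P` up to an `F_σ` set of topological dimension less than `n`. -/
def SmallModulo (P : Set K → Prop) (n : ℕ) (A : Set K) : Prop :=
  ∃ C : ℕ → Set K, (∀ i, IsClosed (C i)) ∧ DimLt n (⋃ i, C i) ∧ P (A \ ⋃ i, C i)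

lemma isSmallness_empty : IsSmallness (fun A : Set K => A = ∅) (fun _ C => C = ∅) where
  empty := rfl
  mono A B hAB hB := subset_eq_empty hAB hB
  closed_cover A C _ hA h := by
    rw [eq_empty_iff_forall_notMem]
    intro x hx
    obtain ⟨j, hj⟩ := mem_iUnion.1 (hA hx)
    exact (h j).subset ⟨hx, hj⟩
  hull A hA := ⟨∅, IsGδ.empty, hA.subset, rfl⟩
  open_upper _ C hC := ⟨∅, isOpen_empty, hC.subset, fun C' h => subset_empty_iff.1 h⟩
  iff_of_isClosed C _ := ⟨fun h _ => h, fun h => h 0⟩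

lemma SmallModulo.dimLt {n : ℕ} {A : Set K} (h : SmallModulo (fun A => A = ∅) n A) : DimLt n A := by
  obtain ⟨C, -, h2, h3⟩ := h
  exact h2.mono (sdiff_eq_empty.1 h3)

lemma SmallModulo.mono {P : Set K → Prop} (hP : IsClosedIdeal P) {n : ℕ}
    {A B : Set K} (h : SmallModulo P n B) (hAB : A ⊆ B) : SmallModulo P n A := by
  obtain ⟨C, h1, h2, h3⟩ := h
  exact ⟨C, h1, h2, hP.mono _ _ (sdiff_subset_sdiff_left hAB) h3⟩

lemma smallModulo_empty {P : Set K → Prop} (hP : IsClosedIdeal P) (n : ℕ) : SmallModulo P n (∅ : Set K) := by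
  refine ⟨fun _ => ∅, fun _ => isClosed_empty, ?_, ?_⟩
  · rw [iUnion_empty]
    exact (dimLt_zero_iff.2 rfl).of_le (Nat.zero_le n)
  · exact hP.mono _ _ sdiff_subset hP.empty

lemma smallModulo_of_closed_cover [CompactSpace K] {P : Set K → Prop} (hP : IsClosedIdeal P)
    {n : ℕ} {A : Set K} {L : ℕ → Set K} (hL : ∀ j, IsClosed (L j)) (hA : A ⊆ ⋃ j, L j)
    (h : ∀ j, SmallModulo P n (A ∩ L j)) : SmallModulo P n A := by
  choose C h1 h2 h3 using h
  have hU : ⋃ m : ℕ, C m.unpair.1 m.unpair.2 = ⋃ j, ⋃ i, C j i := by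
    ext x
    simp only [mem_iUnion]
    constructor
    · rintro ⟨m, hm⟩; exact ⟨_, _, hm⟩
    · rintro ⟨j, i, hm⟩; exact ⟨Nat.pair j i, by simpa using hm⟩
  refine ⟨fun m => C m.unpair.1 m.unpair.2, fun m => h1 _ _, ?_, ?_⟩
  · refine dimLt_of_closed_cover (C := fun m => C m.unpair.1 m.unpair.2) (fun m => h1 _ _)
      subset_rfl fun m => ?_
    exact (h2 m.unpair.1).mono (inter_subset_right.trans (subset_iUnion (C m.unpair.1) m.unpair.2))
  · rw [hU]
    refine hP.closed_cover _ L hL (sdiff_subset.trans hA) fun j => hP.mono _ _ ?_ (h3 j)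
    rintro x ⟨⟨hxA, hx⟩, hxL⟩
    exact ⟨⟨hxA, hxL⟩, fun h => hx (mem_iUnion.2 ⟨j, h⟩)⟩

variable [CompactSpace K]

/-- The map to `ℝⁿ` with coordinates chosen from a sequence. -/
def selectMap {n : ℕ} (e : Fin n → ℕ) (F : ℕ → C(K, ℝ)) : C(K, Fin n → ℝ) :=
  ⟨fun x i => F (e i) x, continuous_pi fun i => (F (e i)).continuous⟩

lemma continuous_selectMap {n : ℕ} (e : Fin n → ℕ) :
    Continuous (selectMap e : (ℕ → C(K, ℝ)) → C(K, Fin n → ℝ)) := by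
  refine ContinuousMap.continuous_of_continuous_uncurry _ ?_
  simp only [Function.uncurry_def, selectMap, ContinuousMap.coe_mk]
  fun_prop

lemma continuous_coordMap {n : ℕ} (i : Fin n) :
    Continuous (fun f : C(K, Fin n → ℝ) => coordMap f i) := by
  refine ContinuousMap.continuous_of_continuous_uncurry _ ?_
  simp only [Function.uncurry_def, coordMap, ContinuousMap.coe_mk]
  fun_prop

lemma dense_preimage_selectMap {n : ℕ} {e : Fin n → ℕ} (he : Function.Injective e)
    {D : Set C(K, Fin n → ℝ)} (hD : Dense D) : Dense (selectMap e ⁻¹' D) := by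
  classical
  intro F
  let σ : C(K, Fin n → ℝ) → ℕ → C(K, ℝ) := fun g => Function.extend e (fun i => coordMap g i) F
  have hσ : Continuous σ := by
    refine continuous_pi fun j => ?_
    by_cases hj : ∃ i, e i = j
    · obtain ⟨i, rfl⟩ := hj
      simp only [σ, he.extend_apply]
      exact continuous_coordMap i
    · simp only [σ, Function.extend_apply' _ _ _ hj]
      exact continuous_const
  have h1 : ∀ g, selectMap e (σ g) = g := fun g => by
    ext x i
    simp only [selectMap, σ, ContinuousMap.coe_mk, he.extend_apply]
    rfl
  have h2 : σ (selectMap e F) = F := by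
    funext j
    by_cases hj : ∃ i, e i = j
    · obtain ⟨i, rfl⟩ := hj
      simp only [σ, he.extend_apply]
      rfl
    · simp only [σ, Function.extend_apply' _ _ _ hj]
  have h3 : σ (selectMap e F) ∈ closure (σ '' D) :=
    image_closure_subset_closure_image hσ ⟨_, hD _, rfl⟩
  rw [h2] at h3
  refine closure_mono ?_ h3
  rintro _ ⟨g, hg, rfl⟩
  rw [mem_preimage, h1]
  exact hg

lemma eventually_denseRange :
    ∀ᶠ F : ℕ → C(K, ℝ) in residual (ℕ → C(K, ℝ)), DenseRange F := by
  classical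
  obtain ⟨b, hbc, hbe, hb⟩ := exists_countable_basis C(K, ℝ)
  have : ∀ᶠ F : ℕ → C(K, ℝ) in residual (ℕ → C(K, ℝ)), ∀ U ∈ b, ∃ j, F j ∈ U := by
    rw [eventually_countable_ball hbc]
    intro U hU
    obtain ⟨u, hu⟩ : U.Nonempty := nonempty_iff_ne_empty.2 fun h => hbe (h ▸ hU)
    refine residual_of_dense_open ?_ ?_
    · simp only [ofPred_exists]
      exact isOpen_iUnion fun j => (hb.isOpen hU).preimage (continuous_apply j)
    · intro F
      refine mem_closure_of_tendsto (f := fun m : ℕ => Function.update F m u) (b := atTop) ?_ ?_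
      · rw [tendsto_pi_nhds]
        intro j
        refine tendsto_const_nhds.congr' ?_
        filter_upwards [eventually_gt_atTop j] with m hm
        rw [Function.update_of_ne hm.ne]
      · exact Eventually.of_forall fun m => ⟨m, by simpa using hu⟩
  filter_upwards [this] with F hF
  rw [DenseRange, hb.dense_iff]
  intro U hU _
  obtain ⟨j, hj⟩ := hF U hU
  exact ⟨F j, hj, mem_range_self j⟩

/-- The points with exactly `k` rational coordinates. -/
def ratPoints (F : ℕ → C(K, ℝ)) (k : ℕ) : Set K :=
  {x | {j | ∃ q : ℚ, F j x = q}.encard = k}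

lemma zeroDim_ratPoints {F : ℕ → C(K, ℝ)} (hF : DenseRange F) (k : ℕ) : ZeroDim (ratPoints F k) := by
  classical
  obtain ⟨T, hT⟩ := exists_surjective_nat (Finset (ℕ × ℚ))
  let C : ℕ → Set K := fun m => if ((T m).image Prod.fst).card = k then
    {x | ∀ p ∈ T m, F p.1 x = p.2} else ∅
  refine zeroDim_of_closed_cover (C := C) (fun m => ?_) (fun x hx => ?_) fun m => ?_
  · simp only [C]
    split_ifs
    · simp only [ofPred_forall]
      exact isClosed_iInter fun p => isClosed_iInter fun _ =>
        isClosed_eq (F p.1).continuous continuous_const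
    · exact isClosed_empty
  · have hx' : {j | ∃ q : ℚ, F j x = q}.encard = k := hx
    have hfin := finite_of_encard_eq_coe hx'
    have hq : ∀ j ∈ hfin.toFinset, ∃ q : ℚ, F j x = q := fun j hj => by simpa using hj
    choose! q hq using hq
    obtain ⟨m, hm⟩ := hT (hfin.toFinset.image fun j => (j, q j))
    refine mem_iUnion.2 ⟨m, ?_⟩
    have hcard : ((T m).image Prod.fst).card = k := by
      rw [hm, Finset.image_image]
      have : (Prod.fst ∘ fun j => (j, q j)) = id := rfl
      rw [this, Finset.image_id]
      rw [hfin.encard_eq_coe_toFinset_card] at hx'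
      exact_mod_cast hx'
    simp only [C, if_pos hcard]
    rw [mem_ofPred_eq, hm]
    intro p hp
    obtain ⟨j, hj, rfl⟩ := Finset.mem_image.1 hp
    exact hq j hj
  · rintro x ⟨hx, hxC⟩ U hU hxU
    simp only [C] at hxC ⊢
    split_ifs at hxC with hcard
    swap
    · exact hxC.elim
    rw [if_pos hcard]
    obtain ⟨r, hr, hrU⟩ := Metric.isOpen_iff.1 hU x hxU
    let φ : C(K, ℝ) := ⟨fun y => dist y x, by fun_prop⟩
    obtain ⟨j, hj⟩ := hF.exists_dist_lt φ (show 0 < r / 4 by positivity)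
    have hj' : ∀ y, |dist y x - F j y| < r / 4 := fun y =>
      ((Real.dist_eq _ _).symm.trans_le (ContinuousMap.dist_apply_le_dist (f := φ) y)).trans_lt hj
    obtain ⟨c, hc1, hc2⟩ := exists_rat_btwn (show r / 4 < 3 * r / 4 by linarith)
    have hxc : F j x < c := by
      have := abs_lt.1 (hj' x)
      rw [dist_self] at this
      linarith
    refine ⟨{y | F j y < c}, isOpen_lt (F j).continuous continuous_const, hxc, fun y hy => ?_, ?_⟩
    · apply hrU
      have := abs_lt.1 (hj' y)
      rw [mem_ofPred_eq] at hy
      rw [mem_ball]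
      linarith
    · rw [Set.disjoint_left]
      rintro y hy ⟨hy1, hy2⟩
      have hyc : F j y = c := frontier_lt_subset_eq (F j).continuous continuous_const hy
      have hy1' : {j | ∃ q : ℚ, F j y = q}.encard = k := hy1
      have hsub : (((T m).image Prod.fst : Finset ℕ) : Set ℕ) ⊆ {j | ∃ q : ℚ, F j y = q} := by
        intro i hi
        obtain ⟨p, hp, rfl⟩ := Finset.mem_image.1 (Finset.mem_coe.1 hi)
        exact ⟨p.2, hy2 p hp⟩
      have heq := (Finset.finite_toSet _).eq_of_subset_of_encard_le hsub (by
        rw [hy1', encard_coe_eq_coe_finsetCard, hcard])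
      have hj : j ∈ (((T m).image Prod.fst : Finset ℕ) : Set ℕ) := by
        rw [heq]; exact ⟨c, hyc⟩
      obtain ⟨p, hp, rfl⟩ := Finset.mem_image.1 (Finset.mem_coe.1 hj)
      have e1 := hxC p hp
      have e2 := hy2 p hp
      rw [e1, ← e2, hyc] at hxc
      exact lt_irrefl _ hxc

lemma dimLt_of_forall_selectMap_ne {F : ℕ → C(K, ℝ)} (hF : DenseRange F) {n : ℕ} {A : Set K}
    (hA : ∀ x ∈ A, ∀ e : Fin n → ℕ, Function.Injective e → ∀ q : Fin n → ℚ,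
      selectMap e F x ≠ fun i => (q i : ℝ)) : DimLt n A := by
  refine ⟨fun k => ratPoints F k, fun k => zeroDim_ratPoints hF k, fun x hx => ?_⟩
  by_cases h : {j | ∃ q : ℚ, F j x = q}.encard < n
  · obtain ⟨k, hk⟩ := ENat.ne_top_iff_exists.1 (ne_top_of_lt h)
    rw [← hk] at h
    refine mem_iUnion.2 ⟨⟨k, by exact_mod_cast h⟩, ?_⟩
    exact hk.symm
  · rw [not_lt] at h
    obtain ⟨S, hS, hcard⟩ := exists_subset_encard_eq h
    have hfin : S.Finite := finite_of_encard_eq_coe hcard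
    have hcard' : Nat.card S = n := by
      rw [Nat.card_coe_set_eq, ncard, hcard]; rfl
    have : Finite S := hfin
    let e : Fin n ≃ S := (Finite.equivFinOfCardEq hcard').symm
    choose q hq using fun i => hS (e i).2
    refine (hA x hx (fun i => e i) (Subtype.val_injective.comp e.injective) q ?_).elim
    funext i
    exact hq i

end GenericSequences

section Reduction

variable {K : Type*} [MetricSpace K] [CompactSpace K] {P : Set K → Prop} {O : ℕ → Set K → Prop}

lemma IsSmallness.isOpen_fiber (hP : IsSmallness P O) {n : ℕ} {L : Set K} (hL : IsClosed L)
    (k : ℕ) (q : Fin n → ℝ) : IsOpen {f : C(K, Fin n → ℝ) | O k (f ⁻¹' {q} ∩ L)} := by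
  rw [isOpen_iff_mem_nhds]
  intro f hf
  obtain ⟨U, hU, hfU, hUO⟩ := hP.open_upper k _ hf
  have hQ : IsCompact (L \ U) := (hL.sdiff hU).isCompact
  have h1 : MapsTo f (L \ U) {q}ᶜ := fun x hx hxq => hx.2 (hfU ⟨hxq, hx.1⟩)
  filter_upwards [(ContinuousMap.isOpen_setOfPred_mapsTo hQ isOpen_compl_singleton).mem_nhds h1]
    with g hg
  refine hUO _ fun x hx => ?_
  by_contra hxU
  exact hg ⟨hx.2, hxU⟩ hx.1

lemma IsSmallness.smallModulo_of_dense (hP : IsSmallness P O) {n : ℕ} {L : Set K} (hL : IsClosed L)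
    (h : ∀ k, Dense {f : C(K, Fin n → ℝ) | O k (f ⁻¹' {0} ∩ L)}) : SmallModulo P n L := by
  classical
  have hq : ∀ k (q : Fin n → ℝ), Dense {f : C(K, Fin n → ℝ) | O k (f ⁻¹' {q} ∩ L)} := by
    intro k q
    have := (h k).preimage
      (Homeomorph.subRight (ContinuousMap.const K q : C(K, Fin n → ℝ))).isOpenMap
    convert this using 1
    ext f
    simp only [mem_ofPred_eq, mem_preimage, Homeomorph.coe_subRight]
    have : ∀ f : C(K, Fin n → ℝ), (f - ContinuousMap.const K q) ⁻¹' {0} = f ⁻¹' {q} := by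
      intro f
      ext x
      simp [sub_eq_zero]
    rw [this]
  let I := {e : Fin n → ℕ // Function.Injective e} × (Fin n → ℚ)
  have : ∀ᶠ F : ℕ → C(K, ℝ) in residual (ℕ → C(K, ℝ)), DenseRange F ∧
      ∀ (p : I) (k : ℕ), O k (selectMap p.1 F ⁻¹' {fun i => (p.2 i : ℝ)} ∩ L) := by
    refine eventually_denseRange.and ?_
    rw [eventually_countable_forall]; intro p
    rw [eventually_countable_forall]; intro k
    exact residual_of_dense_open ((hP.isOpen_fiber hL k _).preimage (continuous_selectMap p.1.1))
      (dense_preimage_selectMap p.1.2 (hq k _))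
  obtain ⟨F, hF, hFO⟩ := (dense_of_mem_residual this).nonempty
  have : Nonempty I := ⟨⟨⟨fun i => i, Fin.val_injective⟩, 0⟩⟩
  obtain ⟨s, hs⟩ := exists_surjective_nat I
  let B : ℕ → Set K := fun m => selectMap (s m).1 F ⁻¹' {fun i => ((s m).2 i : ℝ)} ∩ L
  have hB : ∀ m, IsClosed (B m) := fun m =>
    (isClosed_singleton.preimage (selectMap (s m).1.1 F).continuous).inter hL
  have hPB : P (⋃ m, B m) := by
    refine hP.closed_cover _ B hB subset_rfl fun m => hP.mono _ _ inter_subset_right ?_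
    rw [hP.iff_of_isClosed _ (hB m)]
    exact hFO (s m)
  obtain ⟨G, hG, hBG, hPG⟩ := hP.hull _ hPB
  obtain ⟨U, hU, rfl⟩ := isGδ_iff_eq_iInter_nat.1 hG
  have hun : ⋃ m, L ∩ (U m)ᶜ = L \ ⋂ m, U m := by
    rw [← inter_iUnion, ← compl_iInter]
    rfl
  refine ⟨fun m => L ∩ (U m)ᶜ, fun m => hL.inter (hU m).isClosed_compl, ?_, ?_⟩
  · rw [hun]
    refine dimLt_of_forall_selectMap_ne hF fun x hx e he q hxq => hx.2 (hBG ?_)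
    obtain ⟨m, hm⟩ := hs (⟨e, he⟩, q)
    refine mem_iUnion.2 ⟨m, ?_, hx.1⟩
    rw [hm]
    exact hxq
  · refine hP.mono _ _ ?_ hPG
    rw [hun]
    intro x hx
    by_contra hxU
    exact hx.2 ⟨hx.1, hxU⟩

lemma IsSmallness.exists_robust (hP : IsSmallness P O) {n : ℕ} {L : Set K} (hL : IsClosed L)
    (h : ¬ SmallModulo P n L) : ∃ (g : C(K, Fin n → ℝ)) (r : ℝ), 0 < r ∧
      ∀ f : C(K, Fin n → ℝ), (∀ x ∈ L, dist (f x) (g x) ≤ r) → ¬ P (f ⁻¹' {0} ∩ L) := by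
  have h1 : ∃ k, ¬ Dense {f : C(K, Fin n → ℝ) | O k (f ⁻¹' {0} ∩ L)} := by
    by_contra! h2
    exact h (hP.smallModulo_of_dense hL h2)
  obtain ⟨k, hk⟩ := h1
  rw [Metric.dense_iff] at hk
  push Not at hk
  obtain ⟨g, r, hr, hgr⟩ := hk
  refine ⟨g, r / 2, by positivity, fun f hf hPf => ?_⟩
  obtain ⟨f', hf1, hf2⟩ := exists_perturbation (ι := Unit) (L := fun _ _ => L) (fun _ _ => hL)
    (fun _ => Subsingleton.pairwise) g (fun i _ => coordMap f i) (half_pos hr).le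
    (fun i _ x hx => by
      refine le_trans ?_ (hf x hx)
      exact (Real.dist_eq _ _).symm.trans_le (dist_le_pi_dist (f x) (g x) i))
  have hfib : f' ⁻¹' {0} ∩ L = f ⁻¹' {0} ∩ L := by
    ext x
    simp only [mem_inter_iff, mem_preimage, mem_singleton_iff, and_congr_left_iff]
    intro hx
    have : f' x = f x := funext fun i => hf1 i () x hx
    rw [this]
  rw [hP.iff_of_isClosed _ ((isClosed_singleton.preimage f.continuous).inter hL), ← hfib] at hPf
  have : f' ∈ ball g r ∩ {f : C(K, Fin n → ℝ) | O k (f ⁻¹' {0} ∩ L)} :=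
    ⟨by rw [mem_ball]; linarith, hPf k⟩
  rw [hgr] at this
  exact this

/-- The kernel of a set which is not small. -/
lemma IsClosedIdeal.exists_kernel (hP : IsClosedIdeal P) {n : ℕ}
    (h : ¬ SmallModulo P n (univ : Set K)) :
    ∃ Q : Set K, IsClosed Q ∧ Q.Nonempty ∧
      ∀ V, IsOpen V → (V ∩ Q).Nonempty → ¬ SmallModulo P n (V ∩ Q) := by
  have hK : Nonempty K := by
    by_contra hK
    rw [not_nonempty_iff] at hK
    rw [univ_eq_empty_iff.2 hK] at h
    exact h (smallModulo_empty hP n)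
  let Q : Set K := {x | ∀ V ∈ 𝓝 x, ¬ SmallModulo P n V}
  have hQc : IsClosed Q := by
    rw [← isOpen_compl_iff, isOpen_iff_mem_nhds]
    intro x hx
    simp only [Q, mem_compl_iff, mem_ofPred_eq, not_forall, not_not] at hx
    obtain ⟨V, hV, hVs⟩ := hx
    filter_upwards [eventually_mem_nhds_iff.2 hV] with z hz hzQ
    exact hzQ V hz hVs
  have hM : ∀ x, ∃ M, IsClosed M ∧ SmallModulo P n M ∧ (x ∈ Qᶜ → M ∈ 𝓝 x) := by
    intro x
    by_cases hx : x ∈ Q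
    · exact ⟨∅, isClosed_empty, smallModulo_empty hP n, fun h => (h hx).elim⟩
    · have hx' := hx
      simp only [Q, mem_ofPred_eq, not_forall, not_not] at hx'
      obtain ⟨V, hV, hVs⟩ := hx'
      obtain ⟨M, h1, h2, h3⟩ := exists_mem_nhds_isClosed_subset hV
      exact ⟨M, h2, hVs.mono hP h3, fun _ => h1⟩
  choose M hMc hMs hMn using hM
  obtain ⟨s, -, hsc, hs⟩ := TopologicalSpace.countable_cover_nhdsWithin (s := Qᶜ) (f := M)
    fun x hx => mem_nhdsWithin_of_mem_nhds (hMn x hx)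
  obtain ⟨t, ht⟩ := countable_iff_exists_subset_range.1 hsc
  have key : ∀ V : Set K, SmallModulo P n (V ∩ Q) → SmallModulo P n V := by
    intro V hV
    refine smallModulo_of_closed_cover hP (L := fun j => Nat.casesOn j Q fun j => M (t j))
      (fun j => ?_) (fun x _ => ?_) fun j => ?_
    · cases j
      exacts [hQc, hMc _]
    · by_cases hx : x ∈ Q
      · exact mem_iUnion.2 ⟨0, hx⟩
      · obtain ⟨z, hz, hxz⟩ := mem_iUnion₂.1 (hs hx)
        obtain ⟨j, rfl⟩ := ht hz
        exact mem_iUnion.2 ⟨j + 1, hxz⟩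
    · cases j
      exacts [hV, (hMs _).mono hP inter_subset_right]
  refine ⟨Q, hQc, ?_, fun V hV hne hs => ?_⟩
  · rw [nonempty_iff_ne_empty]
    intro he
    refine h (key univ ?_)
    rw [he, inter_empty]
    exact smallModulo_empty hP n
  · obtain ⟨x, hxV, hxQ⟩ := hne
    exact hxQ V (hV.mem_nhds hxV) (key V hs)

/-- If `g` witnesses robustness on `L`, then any map can be perturbed to a robust one, as long as it
is nearly constant on `L`. -/
lemma exists_scaled_perturbation {n : ℕ} {L : Set K} (hL : IsClosed L) (f g : C(K, Fin n → ℝ))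
    {r ε : ℝ} (hr : 0 < r) (hε : 0 < ε) (c : Fin n → ℝ) (hfc : ∀ x ∈ L, dist (f x) c ≤ ε / 2) :
    ∃ (h : C(K, Fin n → ℝ)) (δ : ℝ), dist h f ≤ ε ∧ 0 < δ ∧
      ∀ f' : C(K, Fin n → ℝ), dist f' h < δ → ∀ y, dist y c < δ →
        ∃ f'' : C(K, Fin n → ℝ), (∀ x ∈ L, dist (f'' x) (g x) ≤ r) ∧ f' ⁻¹' {y} = f'' ⁻¹' {0} := by
  set s : ℝ := ε / 2 / (‖g‖ + 1) with hs
  have hg : 0 < ‖g‖ + 1 := by positivity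
  have hs0 : 0 < s := by positivity
  obtain ⟨h, hh1, hh2⟩ := exists_perturbation (ι := Unit) (L := fun _ _ => L) (fun _ _ => hL)
    (fun _ => Subsingleton.pairwise) f (fun i _ => coordMap (ContinuousMap.const K c + s • g) i)
    hε.le
    (fun i _ x hx => by
      have e1 : |f x i - c i| ≤ ε / 2 :=
        ((Real.dist_eq _ _).symm.trans_le (dist_le_pi_dist (f x) c i)).trans (hfc x hx)
      have e2 : |g x i| ≤ ‖g‖ := (norm_le_pi_norm (g x) i).trans (g.norm_coe_le_norm x)
      have e3 : |s * g x i| ≤ ε / 2 := by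
        rw [abs_mul, abs_of_pos hs0, hs, div_mul_eq_mul_div, div_le_iff₀ hg]
        gcongr
        linarith
      have e4 : coordMap (ContinuousMap.const K c + s • g) i x - f x i
          = s * g x i - (f x i - c i) := by
        simp only [coordMap, ContinuousMap.coe_mk, ContinuousMap.add_apply,
          ContinuousMap.const_apply, ContinuousMap.smul_apply, Pi.add_apply, Pi.smul_apply,
          smul_eq_mul]
        ring
      rw [e4]
      linarith [abs_sub (s * g x i) (f x i - c i)])
  have hhL : ∀ x ∈ L, h x = c + s • g x := fun x hx => funext fun i => hh1 i () x hx
  refine ⟨h, s * r / 2, hh2, by positivity, fun f' hf' y hy => ?_⟩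
  refine ⟨s⁻¹ • (f' - ContinuousMap.const K y), fun x hx => ?_, ?_⟩
  · rw [dist_eq_norm]
    have e1 : (s⁻¹ • (f' - ContinuousMap.const K y)) x - g x = s⁻¹ • ((f' x - h x) - (y - c)) := by
      rw [hhL x hx]
      simp only [ContinuousMap.smul_apply, ContinuousMap.sub_apply, ContinuousMap.const_apply]
      rw [show f' x - (c + s • g x) - (y - c) = (f' x - y) - s • g x by abel, smul_sub _ (_ - _),
        inv_smul_smul₀ hs0.ne']
    rw [e1, norm_smul, norm_inv, Real.norm_of_nonneg hs0.le, inv_mul_le_iff₀ hs0]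
    have e2 := (dist_eq_norm (f' x) (h x)).symm.trans_le (ContinuousMap.dist_apply_le_dist x)
    have e3 := dist_eq_norm y c
    linarith [norm_sub_le (f' x - h x) (y - c)]
  · ext x
    simp [sub_eq_zero, hs0.ne']

lemma IsSmallness.eventually_exists_open_fibers (hP : IsSmallness P O) {n : ℕ}
    (h : ¬ SmallModulo P n (univ : Set K)) :
    ∀ᶠ f : C(K, Fin n → ℝ) in residual C(K, Fin n → ℝ),
      ∃ U : Set (Fin n → ℝ), IsOpen U ∧ U.Nonempty ∧ ∀ y ∈ U, ¬ P (f ⁻¹' {y}) := by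
  obtain ⟨Q, -, ⟨x₀, hx₀Q⟩, hQ⟩ := hP.exists_kernel h
  have hx₀ : ∀ L ∈ 𝓝 x₀, ¬ SmallModulo P n L := fun L hL hLs =>
    hQ _ isOpen_interior ⟨x₀, mem_interior_iff_mem_nhds.2 hL, hx₀Q⟩
      (hLs.mono hP.toIsClosedIdeal (inter_subset_left.trans interior_subset))
  set T : Set (C(K, Fin n → ℝ) × (Fin n → ℝ)) := interior {p | ¬ P (p.1 ⁻¹' {p.2})} with hT
  have h1 : ∀ᶠ f : C(K, Fin n → ℝ) in residual C(K, Fin n → ℝ), f ∈ Prod.fst '' T := by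
    refine residual_of_dense_open (isOpenMap_fst _ isOpen_interior) ?_
    rw [Metric.dense_iff]
    intro f r hr
    obtain ⟨η, hη, hfη⟩ := Metric.continuous_iff.1 f.continuous x₀ (r / 2 / 2) (by positivity)
    have hLn : closedBall x₀ (η / 2) ∈ 𝓝 x₀ := closedBall_mem_nhds _ (by positivity)
    obtain ⟨g, r', hr', hg⟩ := hP.exists_robust isClosed_closedBall (hx₀ _ hLn)
    obtain ⟨k, δ, hk, hδ, hk'⟩ := exists_scaled_perturbation isClosed_closedBall f g hr' (half_pos hr)
      (f x₀) (L := closedBall x₀ (η / 2)) (fun x hx => (hfη x (by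
        rw [mem_closedBall] at hx; linarith)).le)
    refine ⟨k, by rw [mem_ball]; linarith, ⟨(k, f x₀), ?_, rfl⟩⟩
    rw [hT, mem_interior_iff_mem_nhds]
    filter_upwards [prod_mem_nhds (ball_mem_nhds k hδ) (ball_mem_nhds (f x₀) hδ)] with p hp
    obtain ⟨f'', h1, h2⟩ := hk' p.1 hp.1 p.2 hp.2
    rw [h2]
    exact fun hcon => hg f'' h1 (hP.mono _ _ inter_subset_left hcon)
  filter_upwards [h1] with f hf
  obtain ⟨⟨f', y⟩, hy, rfl⟩ := hf
  refine ⟨(fun y => (f', y)) ⁻¹' T, isOpen_interior.preimage (by fun_prop), ⟨y, hy⟩, fun y' hy' => ?_⟩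
  exact interior_subset (s := {p : C(K, Fin n → ℝ) × (Fin n → ℝ) | ¬ P (p.1 ⁻¹' {p.2})}) hy'

end Reduction

section SmallnessInstances

lemma SmallCover.mono {K : Type*} [MetricSpace K] {m : ℕ} {ε δ : ℝ} {C : Set K}
    (h : SmallCover m ε C) (hεδ : ε ≤ δ) : SmallCover m δ C := by
  obtain ⟨W, h1, h2, h3, h4⟩ := h
  exact ⟨W, h1, h2, h3, fun i j x hx y hy => (h4 i j x hx y hy).trans_le hεδ⟩

lemma isSmallness_dimLt {K : Type*} [MetricSpace K] [CompactSpace K] (m : ℕ) :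
    IsSmallness (DimLt m : Set K → Prop) (fun k => SmallCover m (1 / ((k : ℝ) + 1))) where
  empty := (dimLt_zero_iff.2 rfl).of_le (Nat.zero_le m)
  mono _ _ hAB hB := hB.mono hAB
  closed_cover _ _ hC hA h := dimLt_of_closed_cover hC hA h
  hull _ hA := hA.exists_isGδ_superset
  open_upper k C := by
    rintro ⟨W, h1, h2, h3, h4⟩
    exact ⟨⋃ i, ⋃ j, W i j, isOpen_iUnion fun i => isOpen_iUnion fun j => h1 i j, h3,
      fun C' hC' => ⟨W, h1, h2, hC', h4⟩⟩
  iff_of_isClosed C hC := by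
    refine ⟨fun h k => h.smallCover (by positivity), fun h => ?_⟩
    have hS : ∀ ε > 0, SmallCover m ε C := fun ε hε => by
      obtain ⟨k, hk⟩ := exists_nat_one_div_lt hε
      exact (h k).mono hk.le
    exact (isSmallness_empty.smallModulo_of_dense hC fun _ => dense_fiber_zero_avoids hC hS).dimLt

/-- The open covers witnessing that the Hausdorff dimension is at most `q`. -/
def HausdorffCover {K : Type*} [MetricSpace K] (q : ℝ≥0) (k : ℕ) (A : Set K) : Prop :=
  ∃ U : ℕ → Set K, (∀ i, IsOpen (U i)) ∧ A ⊆ ⋃ i, U i ∧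
    ∑' i, ediam (U i) ^ ((q : ℝ) + ((k : ℝ) + 1)⁻¹) ≤ ((k : ℝ≥0∞) + 1)⁻¹

lemma exists_open_ediam_rpow_le {K : Type*} [MetricSpace K] (t : Set K) {s : ℝ} (hs : 0 ≤ s)
    {ε : ℝ≥0} (hε : 0 < ε) : ∃ U, IsOpen U ∧ t ⊆ U ∧ ediam U ^ s ≤ ediam t ^ s + ε := by
  rcases eq_or_ne (ediam t ^ s) ⊤ with htop | htop
  · exact ⟨univ, isOpen_univ, subset_univ _, by rw [htop]; simp⟩
  have hc : Tendsto (fun δ : ℝ≥0 => (ediam t + 2 * (δ : ℝ≥0∞)) ^ s) (𝓝[>] 0) (𝓝 (ediam t ^ s)) := by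
    have h1 : Tendsto (fun δ : ℝ≥0 => ediam t + 2 * (δ : ℝ≥0∞)) (𝓝[>] 0) (𝓝 (ediam t)) := by
      have h2 : Tendsto (fun δ : ℝ≥0 => 2 * (δ : ℝ≥0∞)) (𝓝 0) (𝓝 (2 * ((0 : ℝ≥0) : ℝ≥0∞))) :=
        ENNReal.Tendsto.const_mul (ENNReal.tendsto_coe.2 tendsto_id) (Or.inr (by simp))
      have h3 := (tendsto_const_nhds (x := ediam t)).add h2
      simp only [ENNReal.coe_zero, mul_zero, add_zero] at h3
      exact h3.mono_left nhdsWithin_le_nhds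
    exact (ENNReal.continuous_rpow_const.tendsto _).comp h1
  have hlt : ediam t ^ s < ediam t ^ s + ε := ENNReal.lt_add_right htop (by simpa using hε.ne')
  obtain ⟨δ, hδ, hδ0⟩ := ((hc.eventually (gt_mem_nhds hlt)).and self_mem_nhdsWithin).exists
  refine ⟨thickening δ t, isOpen_thickening, self_subset_thickening ?_ _, ?_⟩
  · exact_mod_cast hδ0
  · exact (ENNReal.rpow_le_rpow (ediam_thickening_le δ) hs).trans hδ.le

lemma hausdorffCover_of_dimH_le {K : Type*} [MetricSpace K] {q : ℝ≥0} {A : Set K}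
    (h : dimH A ≤ q) (k : ℕ) : HausdorffCover q k A := by
  let _ : MeasurableSpace K := borel K
  have : BorelSpace K := ⟨rfl⟩
  set s : ℝ≥0 := q + ((k : ℝ≥0) + 1)⁻¹ with hs
  have hs0 : 0 < s := by positivity
  have hs' : (s : ℝ) = (q : ℝ) + ((k : ℝ) + 1)⁻¹ := by rw [hs]; push_cast; rfl
  have hμ : MeasureTheory.Measure.hausdorffMeasure (s : ℝ) A = 0 := by
    apply hausdorffMeasure_of_dimH_lt
    refine h.trans_lt ?_
    rw [ENNReal.coe_lt_coe, hs]
    exact lt_add_of_pos_right _ (by positivity)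
  rw [MeasureTheory.Measure.hausdorffMeasure_apply] at hμ
  have hη : (0 : ℝ≥0∞) < ((k : ℝ≥0∞) + 1)⁻¹ / 2 := by
    refine ENNReal.div_pos (ENNReal.inv_ne_zero.2 ?_) (by simp)
    exact ENNReal.add_ne_top.2 ⟨ENNReal.natCast_ne_top k, ENNReal.one_ne_top⟩
  have hlt : (⨅ (t : ℕ → Set K) (_ : A ⊆ ⋃ n, t n) (_ : ∀ n, ediam (t n) ≤ 1),
      ∑' n, ⨆ (_ : (t n).Nonempty), ediam (t n) ^ (s : ℝ)) < ((k : ℝ≥0∞) + 1)⁻¹ / 2 := by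
    refine lt_of_le_of_lt ?_ hη
    rw [← hμ]
    exact le_iSup₂_of_le 1 one_pos le_rfl
  simp only [iInf_lt_iff] at hlt
  obtain ⟨t, ht, -, hsum⟩ := hlt
  obtain ⟨ε, hε, hεsum⟩ := ENNReal.exists_pos_sum_of_countable hη.ne' ℕ
  choose U hU' using fun i => exists_open_ediam_rpow_le (t i) (s := s) s.2 (hε i)
  refine ⟨U, fun i => (hU' i).1, ht.trans (iUnion_mono fun i => (hU' i).2.1), ?_⟩
  rw [← hs']
  calc ∑' i, ediam (U i) ^ (s : ℝ) ≤ ∑' i, ((⨆ (_ : (t i).Nonempty), ediam (t i) ^ (s : ℝ)) + ε i) := by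
        refine ENNReal.tsum_le_tsum fun i => (hU' i).2.2.trans ?_
        gcongr
        rcases (t i).eq_empty_or_nonempty with he | hne
        · rw [he, ediam_empty, ENNReal.zero_rpow_of_pos (by exact_mod_cast hs0)]
          exact bot_le
        · exact le_iSup (fun _ : (t i).Nonempty => ediam (t i) ^ (s : ℝ)) hne
    _ = (∑' i, ⨆ (_ : (t i).Nonempty), ediam (t i) ^ (s : ℝ)) + ∑' i, (ε i : ℝ≥0∞) :=
        ENNReal.tsum_add
    _ ≤ ((k : ℝ≥0∞) + 1)⁻¹ / 2 + ((k : ℝ≥0∞) + 1)⁻¹ / 2 := add_le_add hsum.le hεsum.le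
    _ = ((k : ℝ≥0∞) + 1)⁻¹ := ENNReal.add_halves _

lemma dimH_le_of_hausdorffCover {K : Type*} [MetricSpace K] {q : ℝ≥0} {A : Set K}
    (h : ∀ k, HausdorffCover q k A) : dimH A ≤ q := by
  let _ : MeasurableSpace K := borel K
  have : BorelSpace K := ⟨rfl⟩
  choose U _ hUA hUs using h
  refine dimH_le fun d hd => ?_
  by_contra! hlt
  rw [ENNReal.coe_lt_coe] at hlt
  have hd0 : (0 : ℝ) < d := by exact_mod_cast (zero_le).trans_lt hlt
  have hlt' : (q : ℝ) < d := by exact_mod_cast hlt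
  have hev : ∀ᶠ k : ℕ in atTop, (q : ℝ) + ((k : ℝ) + 1)⁻¹ ≤ d := by
    have h1 : Tendsto (fun k : ℕ => (q : ℝ) + ((k : ℝ) + 1)⁻¹) atTop (𝓝 ((q : ℝ) + 0)) := by
      have := tendsto_one_div_add_atTop_nhds_zero_nat (𝕜 := ℝ)
      simp only [one_div] at this
      exact tendsto_const_nhds.add this
    rw [add_zero] at h1
    exact (h1.eventually (gt_mem_nhds hlt')).mono fun k hk => hk.le
  have hinv1 : ∀ k : ℕ, ((k : ℝ≥0∞) + 1)⁻¹ ≤ 1 := fun k => by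
    rw [ENNReal.inv_le_one]
    exact le_add_self
  have hterm : ∀ k i, ediam (U k i) ≤ 1 := fun k i => by
    have h1 := (ENNReal.le_tsum i).trans ((hUs k).trans (hinv1 k))
    by_contra! h2
    exact absurd h1 (not_le.2 (ENNReal.one_lt_rpow h2 (by positivity)))
  have hle : ∀ᶠ k : ℕ in atTop, ∀ i, ediam (U k i) ^ (d : ℝ) ≤
      ediam (U k i) ^ ((q : ℝ) + ((k : ℝ) + 1)⁻¹) := by
    filter_upwards [hev] with k hk i
    exact ENNReal.rpow_le_rpow_of_exponent_ge (hterm k i) hk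
  have hr : Tendsto (fun k : ℕ => (((k : ℝ≥0∞) + 1)⁻¹) ^ (1 / (d : ℝ))) atTop (𝓝 0) := by
    have h1 : Tendsto (fun k : ℕ => ((k : ℝ≥0∞) + 1)⁻¹) atTop (𝓝 0) := by
      have := (tendsto_add_atTop_iff_nat 1).2 ENNReal.tendsto_inv_nat_nhds_zero
      simpa using this
    have h2 := (ENNReal.continuous_rpow_const (y := 1 / (d : ℝ))).tendsto 0
    rw [ENNReal.zero_rpow_of_pos (by positivity)] at h2
    exact h2.comp h1
  have key := MeasureTheory.Measure.hausdorffMeasure_le_liminf_tsum (d : ℝ) A _ hr U (by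
    filter_upwards [hle] with k hk i
    rw [one_div, ENNReal.le_rpow_inv_iff hd0]
    exact (hk i).trans ((ENNReal.le_tsum i).trans (hUs k))) (Eventually.of_forall hUA)
  rw [hd] at key
  have : liminf (fun k => ∑' i, ediam (U k i) ^ (d : ℝ)) atTop ≤ 1 := by
    refine liminf_le_of_frequently_le' ?_
    refine Eventually.frequently ?_
    filter_upwards [hle] with k hk
    exact (ENNReal.tsum_le_tsum hk).trans ((hUs k).trans (hinv1 k))
  exact absurd (key.trans this) (by simp)

lemma isSmallness_dimH {K : Type*} [MetricSpace K] (q : ℝ≥0) :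
    IsSmallness (fun A : Set K => dimH A ≤ q) (HausdorffCover q) where
  empty := by simp
  mono _ _ hAB hB := (dimH_mono hAB).trans hB
  closed_cover A C _ hA h := by
    have : A = ⋃ j, A ∩ C j := by rw [← inter_iUnion, inter_eq_left.2 hA]
    rw [this, dimH_iUnion]
    exact iSup_le h
  hull A hA := by
    choose U h1 h2 h3 using hausdorffCover_of_dimH_le hA
    refine ⟨⋂ k, ⋃ i, U k i, IsGδ.iInter_of_isOpen fun k => isOpen_iUnion (h1 k),
      subset_iInter h2, dimH_le_of_hausdorffCover fun k => ⟨U k, h1 k, iInter_subset _ k, h3 k⟩⟩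
  open_upper k C := by
    rintro ⟨U, h1, h2, h3⟩
    exact ⟨⋃ i, U i, isOpen_iUnion h1, h2, fun C' hC' => ⟨U, h1, hC', h3⟩⟩
  iff_of_isClosed C _ := ⟨hausdorffCover_of_dimH_le, dimH_le_of_hausdorffCover⟩

end SmallnessInstances

section RichPackings

variable {K : Type*} [MetricSpace K]

/-- There is a finite packing of large `q`-dimensional sum and small radii, all of whose balls
contain a member of `𝓑` with property `Φ` whose closure is contained in `V`. -/
def RichPacking (𝓑 : Set (Set K)) (q : ℝ≥0) (Φ : Set K → Prop) (V : Set K) (k : ℕ) : Prop :=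
  ∃ s : Finset (K × ℝ≥0), (∀ p ∈ s, p.2 ≤ ((k : ℝ≥0) + 1)⁻¹) ∧
    (s : Set (K × ℝ≥0)).Pairwise
      (fun p p' => Disjoint (closedBall p.1 (p.2 : ℝ)) (closedBall p'.1 (p'.2 : ℝ))) ∧
    (k : ℝ≥0) + 1 ≤ ∑ p ∈ s, p.2 ^ (q : ℝ) ∧
    ∀ p ∈ s, ∃ V' ∈ 𝓑, closure V' ⊆ V ∩ ball p.1 ((p.2 : ℝ) / 2) ∧ Φ V'

lemma exists_finset_packing {A : Set K} {q : ℝ≥0} (hq : 0 < q)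
    (h : packPre0 (fun r => r ^ (q : ℝ)) A = ∞) {δ : ℝ≥0} (hδ : 0 < δ) (M : ℝ≥0) :
    ∃ s : Finset (K × ℝ≥0), (∀ p ∈ s, p.1 ∈ A ∧ 0 < p.2 ∧ p.2 ≤ δ) ∧
      (s : Set (K × ℝ≥0)).Pairwise
        (fun p p' => Disjoint (closedBall p.1 (p.2 : ℝ)) (closedBall p'.1 (p'.2 : ℝ))) ∧
      M ≤ ∑ p ∈ s, p.2 ^ (q : ℝ) := by
  classical
  have h1 : (M : ℝ≥0∞) < packPre (fun r => r ^ (q : ℝ)) A δ := by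
    have : packPre (fun r => r ^ (q : ℝ)) A δ = ∞ := by
      rw [eq_top_iff, ← h]
      exact iInf₂_le δ hδ
    rw [this]
    exact ENNReal.coe_lt_top
  simp only [packPre, lt_iSup_iff, ENNReal.tsum_eq_iSup_sum] at h1
  obtain ⟨s, ⟨-, hs1, hs2⟩, t, ht⟩ := h1
  refine ⟨(t.map (Function.Embedding.subtype _)).filter fun p => 0 < p.2, fun p hp => ?_, ?_, ?_⟩
  · obtain ⟨hp1, hp2⟩ := Finset.mem_filter.1 hp
    obtain ⟨p', -, rfl⟩ := Finset.mem_map.1 hp1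
    exact ⟨(hs1 _ p'.2).1, hp2, (hs1 _ p'.2).2⟩
  · refine hs2.mono fun p hp => ?_
    obtain ⟨p', -, rfl⟩ := Finset.mem_map.1 (Finset.mem_filter.1 (Finset.mem_coe.1 hp)).1
    exact p'.2
  · rw [Finset.sum_filter_of_ne]
    · rw [Finset.sum_map]
      rw [← ENNReal.ofNNReal_finsetSum, ENNReal.coe_lt_coe] at ht
      exact ht.le
    · intro p _ hne
      rw [pos_iff_ne_zero]
      rintro h0
      rw [h0, NNReal.zero_rpow (by exact_mod_cast hq.ne')] at hne
      exact hne rfl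

/-- A countable base, containing the whole space. -/
lemma exists_countable_regular_base (K : Type*) [MetricSpace K] [SecondCountableTopology K] :
    ∃ 𝓑 : Set (Set K), 𝓑.Countable ∧ (∀ V ∈ 𝓑, IsOpen V) ∧ univ ∈ 𝓑 ∧
      ∀ U, IsOpen U → ∀ x ∈ U, ∃ V ∈ 𝓑, x ∈ V ∧ closure V ⊆ U := by
  obtain ⟨b, hbc, -, hb⟩ := exists_countable_basis K
  refine ⟨insert univ b, hbc.insert _, ?_, mem_insert _ _, fun U hU x hx => ?_⟩
  · rintro V (rfl | hV)
    exacts [isOpen_univ, hb.isOpen hV]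
  · obtain ⟨M, hM, hMc, hMU⟩ := exists_mem_nhds_isClosed_subset (hU.mem_nhds hx)
    obtain ⟨V, hV, hxV, hVM⟩ := hb.mem_nhds_iff.1 hM
    exact ⟨V, mem_insert_of_mem _ hV, hxV, (closure_minimal hVM hMc).trans hMU⟩

lemma le_pdim_of_richPacking [CompactSpace K] {𝓑 : Set (Set K)} (hbo : ∀ V ∈ 𝓑, IsOpen V)
    (hbu : univ ∈ 𝓑) (hb : ∀ U, IsOpen U → ∀ x ∈ U, ∃ V ∈ 𝓑, x ∈ V ∧ closure V ⊆ U)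
    {q : ℝ≥0} {Φ : Set K → Prop} (hmono : ∀ V W, V ⊆ W → Φ V → Φ W) {Y : Set K} (hY : IsClosed Y)
    (hΦY : ∀ V, Φ V → (V ∩ Y).Nonempty) (hu : Φ univ)
    (hrich : ∀ V ∈ 𝓑, Φ V → ∀ k, RichPacking 𝓑 q Φ V k) : ((q : ℝ) : EReal) ≤ pdim Y := by
  classical
  let A : Set K := {x | ∀ V, IsOpen V → x ∈ V → Φ V}
  have hAc : IsClosed A := by
    rw [← isOpen_compl_iff, isOpen_iff_mem_nhds]
    intro x hx
    simp only [A, mem_compl_iff, mem_ofPred_eq, not_forall] at hx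
    obtain ⟨V, hV, hxV, hΦ⟩ := hx
    filter_upwards [hV.mem_nhds hxV] with z hz hzA
    exact hΦ (hzA V hV hz)
  have hAY : A ⊆ Y := fun x hx => by
    rw [← hY.closure_eq, _root_.mem_closure_iff]
    exact fun V hV hxV => hΦY V (hx V hV hxV)
  have hmeet : ∀ V ∈ 𝓑, Φ V → (A ∩ closure V).Nonempty := by
    intro V hV hΦV
    by_contra hne
    have hW : ∀ x : closure V, ∃ W, IsOpen W ∧ (x : K) ∈ W ∧ ¬ Φ W := by
      intro x
      by_contra! hcon
      exact hne ⟨x, hcon, x.2⟩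
    choose W hWo hxW hWΦ using hW
    obtain ⟨δ, hδ, hball⟩ := lebesgue_number_lemma_of_metric isClosed_closure.isCompact hWo
      (fun x hx => mem_iUnion.2 ⟨⟨x, hx⟩, hxW _⟩)
    obtain ⟨k, hk⟩ := exists_nat_one_div_lt hδ
    obtain ⟨s, hs1, -, hs3, hs4⟩ := hrich V hV hΦV k
    have hsne : s.Nonempty := by
      rw [Finset.nonempty_iff_ne_empty]
      rintro rfl
      rw [Finset.sum_empty] at hs3
      exact absurd hs3 (not_le.2 (by positivity))
    obtain ⟨p, hp⟩ := hsne
    obtain ⟨V', -, hV'c, hΦV'⟩ := hs4 p hp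
    obtain ⟨z, hzV', -⟩ := hΦY V' hΦV'
    have hz := hV'c (subset_closure hzV')
    obtain ⟨i, hi⟩ := hball z (subset_closure hz.1)
    refine hWΦ i (hmono V' _ (fun w hw => hi ?_) hΦV')
    have hw' := (hV'c (subset_closure hw)).2
    have hz' := hz.2
    have hpk : (p.2 : ℝ) ≤ ((k : ℝ) + 1)⁻¹ := by exact_mod_cast hs1 p hp
    rw [one_div] at hk
    rw [mem_ball] at hw' hz' ⊢
    have := dist_triangle_right w z p.1
    linarith
  have hAne : A.Nonempty := (hmeet univ hbu hu).mono inter_subset_left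
  have hpre : ∀ (c V : Set K), IsOpen V → (V ∩ A).Nonempty → V ∩ A ⊆ closure c →
      packPre0 (fun r => r ^ (q : ℝ)) c = ∞ := by
    intro c V hV hne hc
    obtain ⟨x, hxV, hxA⟩ := hne
    obtain ⟨V₀, hV₀, hxV₀, hV₀V⟩ := hb V hV x hxV
    have hΦ₀ := hxA V₀ (hbo _ hV₀) hxV₀
    rw [packPre0, iInf₂_eq_top]
    intro δ hδ
    rw [packPre]
    have hc0 : (0 : ℝ≥0) < (1 / 2) ^ (q : ℝ) := NNReal.rpow_pos (by positivity)
    refine ENNReal.eq_top_of_forall_nnreal_le fun M => ?_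
    obtain ⟨k₁, hk₁⟩ := exists_nat_one_div_lt hδ
    obtain ⟨k₂, hk₂⟩ := exists_nat_ge (M / (1 / 2) ^ (q : ℝ))
    set k := max k₁ k₂
    obtain ⟨s, hs1, hs2, hs3, hs4⟩ := hrich V₀ hV₀ hΦ₀ k
    have hcen : ∀ p ∈ s, ∃ a ∈ c, a ∈ ball p.1 ((p.2 : ℝ) / 2) := by
      intro p hp
      obtain ⟨V', hV', hV'c, hΦV'⟩ := hs4 p hp
      obtain ⟨a, haA, haV'⟩ := hmeet V' hV' hΦV'
      have ha := hV'c haV'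
      obtain ⟨b, hb1, hb2⟩ := _root_.mem_closure_iff.1
        (hc ⟨hV₀V (subset_closure ha.1), haA⟩) _ isOpen_ball ha.2
      exact ⟨b, hb2, hb1⟩
    have : Nonempty K := ⟨x⟩
    choose! a hac hab using hcen
    have hsub : ∀ p ∈ s, closedBall (a p) ((p.2 / 2 : ℝ≥0) : ℝ) ⊆ closedBall p.1 (p.2 : ℝ) := by
      intro p hp
      refine closedBall_subset_closedBall' ?_
      have := hab p hp
      rw [mem_ball] at this
      push_cast
      linarith
    have hdisj : ∀ p ∈ s, ∀ p' ∈ s, p ≠ p' →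
        Disjoint (closedBall (a p) ((p.2 / 2 : ℝ≥0) : ℝ)) (closedBall (a p') ((p'.2 / 2 : ℝ≥0) : ℝ)) :=
      fun p hp p' hp' hne => (hs2 hp hp' hne).mono (hsub p hp) (hsub p' hp')
    have hinj : Set.InjOn (fun p => (a p, p.2 / 2)) (s : Set (K × ℝ≥0)) := by
      intro p hp p' hp' heq
      by_contra hne
      simp only [Prod.mk.injEq] at heq
      refine Set.disjoint_left.1 (hdisj p hp p' hp' hne) (mem_closedBall_self (by positivity)) ?_
      rw [heq.1]
      exact mem_closedBall_self (by positivity)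
    let s' : Finset (K × ℝ≥0) := s.image fun p => (a p, p.2 / 2)
    have hs' : IsPacking c δ (s' : Set (K × ℝ≥0)) := by
      refine ⟨s'.countable_toSet, fun p' hp' => ?_, fun p' hp' p'' hp'' hne => ?_⟩
      · obtain ⟨p, hp, rfl⟩ := Finset.mem_image.1 (Finset.mem_coe.1 hp')
        refine ⟨hac p hp, ?_⟩
        have h1 : (((k : ℝ≥0) + 1)⁻¹ : ℝ≥0) ≤ ((k₁ : ℝ≥0) + 1)⁻¹ := by
          gcongr
          exact le_max_left _ _
        rw [one_div] at hk₁
        exact (half_le_self zero_le).trans ((hs1 p hp).trans (h1.trans hk₁.le))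
      · obtain ⟨p, hp, rfl⟩ := Finset.mem_image.1 (Finset.mem_coe.1 hp')
        obtain ⟨r, hr, rfl⟩ := Finset.mem_image.1 (Finset.mem_coe.1 hp'')
        exact hdisj p hp r hr fun h => hne (by rw [h])
    refine le_trans ?_ (le_iSup₂ (f := fun (s : Set (K × ℝ≥0)) (_ : IsPacking c δ s) =>
      ∑' p : s, ((p.1.2 ^ (q : ℝ) : ℝ≥0) : ℝ≥0∞)) _ hs')
    have h2 : ∑' p : (s' : Set (K × ℝ≥0)), ((p.1.2 ^ (q : ℝ) : ℝ≥0) : ℝ≥0∞) =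
        ((∑ p ∈ s', p.2 ^ (q : ℝ) : ℝ≥0) : ℝ≥0∞) := by
      rw [ENNReal.ofNNReal_finsetSum]
      exact Finset.tsum_subtype' s' fun p => ((p.2 ^ (q : ℝ) : ℝ≥0) : ℝ≥0∞)
    rw [h2, ENNReal.coe_le_coe, Finset.sum_image hinj]
    have h3 : ∀ p : K × ℝ≥0, (p.2 / 2) ^ (q : ℝ) = p.2 ^ (q : ℝ) * (1 / 2) ^ (q : ℝ) := fun p => by
      rw [div_eq_mul_one_div, NNReal.mul_rpow]
    simp only [h3]
    rw [← Finset.sum_mul]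
    rw [div_le_iff₀ hc0] at hk₂
    refine hk₂.trans ?_
    gcongr
    refine le_trans ?_ hs3
    have : (k₂ : ℝ≥0) ≤ k := by exact_mod_cast le_max_right _ _
    exact this.trans (le_add_of_nonneg_right zero_le_one)
  have hmeas : packMeasure (fun r => r ^ (q : ℝ)) A = ∞ := by
    rw [packMeasure, iInf₂_eq_top]
    intro c hcA
    have : CompactSpace A := isCompact_iff_compactSpace.1 hAc.isCompact
    have : Nonempty A := hAne.to_subtype
    obtain ⟨i, hi⟩ := nonempty_interior_of_iUnion_of_closed
      (f := fun i => (Subtype.val ⁻¹' closure (c i) : Set A))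
      (fun i => isClosed_closure.preimage continuous_subtype_val) (by
        rw [eq_univ_iff_forall]
        intro x
        obtain ⟨i, hi⟩ := mem_iUnion.1 (hcA.subset x.2)
        exact mem_iUnion.2 ⟨i, subset_closure hi⟩)
    obtain ⟨V, hV, hVeq⟩ := isOpen_induced_iff.1
      (isOpen_interior (s := (Subtype.val ⁻¹' closure (c i) : Set A)))
    obtain ⟨x, hx⟩ := hi
    rw [← hVeq] at hx
    have htop := hpre (c i) V hV ⟨x, hx, x.2⟩ fun z hz => by
      have : (⟨z, hz.2⟩ : A) ∈ interior (Subtype.val ⁻¹' closure (c i) : Set A) := by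
        rw [← hVeq]; exact hz.1
      exact (interior_subset this : _)
    exact ENNReal.tsum_eq_top_of_eq_top ⟨i, htop⟩
  exact (le_pdim hAne hmeas).trans (isDimension_pdim.mono _ _ hAY)

end RichPackings

section StableValues

variable {K : Type*} [MetricSpace K] {n : ℕ}

/-- The pairs `(f, y)` such that `y` is stably a value of `f` on `A`. -/
def stable (n : ℕ) (A : Set K) : Set (C(K, Fin n → ℝ) × (Fin n → ℝ)) :=
  interior {p | ∃ x ∈ A, p.1 x = p.2}

lemma isOpen_stable (A : Set K) : IsOpen (stable n A) := isOpen_interior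

lemma exists_of_mem_stable {A : Set K} {p : C(K, Fin n → ℝ) × (Fin n → ℝ)} (h : p ∈ stable n A) :
    ∃ x ∈ A, p.1 x = p.2 := interior_subset (s := {p : C(K, Fin n → ℝ) × (Fin n → ℝ) | ∃ x ∈ A, p.1 x = p.2}) h

lemma stable_mono {A B : Set K} (h : A ⊆ B) : stable n A ⊆ stable n B :=
  interior_mono fun _ ⟨x, hx, hp⟩ => ⟨x, h hx, hp⟩

lemma isClosedIdeal_pdim_le (q : ℝ≥0) : IsClosedIdeal fun A : Set K => pdim A ≤ ((q : ℝ) : EReal) where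
  empty := by
    rw [isDimension_pdim.empty]
    exact le_trans (by norm_num) (EReal.coe_nonneg.2 q.2)
  mono A B hAB hB := (isDimension_pdim.mono A B hAB).trans hB
  closed_cover A C hC hA h := isDimension_pdim.closed_cover A C _ hC hA h

variable {𝓑 : Set (Set K)} {Q : Set K}

lemma isOpen_richPacking (q : ℝ≥0) (V : Set K) (k : ℕ) :
    IsOpen {p : C(K, Fin n → ℝ) × (Fin n → ℝ) |
      RichPacking 𝓑 q (fun V' => p ∈ stable n (V' ∩ Q)) V k} := by
  rw [isOpen_iff_eventually]
  rintro p ⟨s, h1, h2, h3, h4⟩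
  have : ∀ᶠ p' in 𝓝 p, ∀ b ∈ s, ∃ V' ∈ 𝓑, closure V' ⊆ V ∩ ball b.1 ((b.2 : ℝ) / 2) ∧
      p' ∈ stable n (V' ∩ Q) := by
    rw [eventually_all_finset]
    intro b hb
    obtain ⟨V', hV', hc, hp⟩ := h4 b hb
    filter_upwards [(isOpen_stable _).mem_nhds hp] with p' hp'
    exact ⟨V', hV', hc, hp'⟩
  filter_upwards [this] with p' hp'
  exact ⟨s, h1, h2, h3, hp'⟩

variable [CompactSpace K]

lemma exists_stable_target {L : Set K} (hL : IsClosed L) (hd : ¬ DimLt n L) {ε : ℝ} (hε : 0 < ε)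
    (c : Fin n → ℝ) : ∃ t : C(K, Fin n → ℝ), (∀ x i, |t x i - c i| ≤ 2 * ε) ∧
      ∀ (h : C(K, Fin n → ℝ)) (y : Fin n → ℝ), (∀ x ∈ L, dist (h x) (t x) ≤ ε) → dist y c ≤ ε →
        ∃ x ∈ L, h x = y := by
  obtain ⟨g, r, hr, hg⟩ := isSmallness_empty.exists_robust hL fun h => hd h.dimLt
  let g' : C(K, Fin n → ℝ) := ⟨fun x i => max (-(r / 2)) (min (r / 2) (g x i)), by fun_prop⟩
  have hg' : ∀ x i, g' x i = max (-(r / 2)) (min (r / 2) (g x i)) := fun _ _ => rfl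
  have hg'l : ∀ x i, -(r / 2) ≤ g' x i := fun x i => le_max_left _ _
  have hg'u : ∀ x i, g' x i ≤ r / 2 := fun x i => max_le (by linarith) (min_le_left _ _)
  let t : C(K, Fin n → ℝ) := ⟨fun x i => c i + 4 * ε / r * g' x i, by fun_prop⟩
  have ht : ∀ x i, t x i = c i + 4 * ε / r * g' x i := fun _ _ => rfl
  refine ⟨t, fun x i => ?_, fun h y hh hy => ?_⟩
  · rw [ht, add_sub_cancel_left, abs_mul, abs_of_pos (by positivity)]
    calc 4 * ε / r * |g' x i| ≤ 4 * ε / r * (r / 2) := by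
          gcongr
          exact abs_le.2 ⟨hg'l x i, hg'u x i⟩
      _ = 2 * ε := by field_simp; norm_num
  · let f : C(K, Fin n → ℝ) := ⟨fun x i => r / (4 * ε) * (h x i - y i) + g x i - g' x i, by fun_prop⟩
    have hf : ∀ x i, f x i = r / (4 * ε) * (h x i - y i) + g x i - g' x i := fun _ _ => rfl
    have hyi : ∀ i, |y i - c i| ≤ ε := fun i =>
      ((Real.dist_eq _ _).symm.trans_le (dist_le_pi_dist y c i)).trans hy
    have hhi : ∀ x ∈ L, ∀ i, |h x i - t x i| ≤ ε := fun x hx i =>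
      ((Real.dist_eq _ _).symm.trans_le (dist_le_pi_dist (h x) (t x) i)).trans (hh x hx)
    have hne := hg f fun x hx => by
      refine (dist_pi_le_iff hr.le).2 fun i => ?_
      have e : f x i - g x i = r / (4 * ε) * ((h x i - t x i) - (y i - c i)) := by
        rw [hf, ht]
        field_simp
        ring
      rw [Real.dist_eq, e, abs_mul, abs_of_pos (by positivity)]
      calc r / (4 * ε) * |(h x i - t x i) - (y i - c i)| ≤ r / (4 * ε) * (2 * ε) := by
            gcongr
            linarith [abs_sub (h x i - t x i) (y i - c i), hyi i, hhi x hx i]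
        _ = r / 2 := by field_simp; norm_num
        _ ≤ r := by linarith
    obtain ⟨x, hx0, hxL⟩ := nonempty_iff_ne_empty.2 hne
    refine ⟨x, hxL, funext fun i => ?_⟩
    have e0 : r / (4 * ε) * (h x i - y i) + g x i - g' x i = 0 := by
      rw [← hf, mem_singleton_iff.1 hx0]; rfl
    have e1 := abs_le.1 (hyi i)
    have e2 := abs_le.1 (hhi x hxL i)
    rw [ht] at e2
    have hpos : 0 < r / (4 * ε) := by positivity
    have e3 : 4 * ε / r * (r / 2) = 2 * ε := by field_simp; norm_num
    have e4 := hg' x i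
    rcases lt_or_ge (r / 2) (g x i) with h1 | h1
    · rw [min_eq_left h1.le, max_eq_right (by linarith)] at e4
      rw [e4, e3] at e2
      have : 0 ≤ r / (4 * ε) * (h x i - y i) := mul_nonneg hpos.le (by linarith)
      linarith
    · rw [min_eq_right h1] at e4
      rcases lt_or_ge (g x i) (-(r / 2)) with h2 | h2
      · rw [max_eq_left h2.le] at e4
        rw [e4, mul_neg, e3] at e2
        have : 0 ≤ r / (4 * ε) * (y i - h x i) := mul_nonneg hpos.le (by linarith)
        linarith
      · rw [max_eq_right h2] at e4
        rw [e4] at e0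
        have : r / (4 * ε) * (h x i - y i) = 0 := by linarith
        rcases mul_eq_zero.1 this with h3 | h3
        · exact absurd h3 hpos.ne'
        · linarith

lemma exists_local_target
    (hbo : ∀ V ∈ 𝓑, IsOpen V) (hb : ∀ U, IsOpen U → ∀ x ∈ U, ∃ V ∈ 𝓑, x ∈ V ∧ closure V ⊆ U)
    (hQc : IsClosed Q) (hQ : ∀ V, IsOpen V → (V ∩ Q).Nonempty → ¬ DimLt n (V ∩ Q))
    {N : Set K} (hN : IsOpen N) {a : K} (haN : a ∈ N) (haQ : a ∈ Q) {ε : ℝ} (hε : 0 < ε)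
    (c : Fin n → ℝ) :
    ∃ V ∈ 𝓑, closure V ⊆ N ∧ ∃ L ⊆ V, IsClosed L ∧ ∃ t : C(K, Fin n → ℝ),
      (∀ x i, |t x i - c i| ≤ 2 * ε) ∧
      ∀ h : C(K, Fin n → ℝ), (∀ x ∈ L, h x = t x) → ∀ y, dist y c < ε →
        (h, y) ∈ stable n (V ∩ Q) := by
  obtain ⟨V, hV, haV, hVN⟩ := hb N hN a haN
  obtain ⟨M, hM, hMc, hMV⟩ := exists_mem_nhds_isClosed_subset ((hbo V hV).mem_nhds haV)
  have hd : ¬ DimLt n (M ∩ Q) := fun h =>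
    hQ _ isOpen_interior ⟨a, mem_interior_iff_mem_nhds.2 hM, haQ⟩
      (h.mono (inter_subset_inter_left _ interior_subset))
  obtain ⟨t, ht1, ht2⟩ := exists_stable_target (hMc.inter hQc) hd hε c
  refine ⟨V, hV, hVN, M ∩ Q, inter_subset_left.trans hMV, hMc.inter hQc, t, ht1, fun h hh y hy => ?_⟩
  rw [stable, mem_interior_iff_mem_nhds]
  have hn : ball h ε ×ˢ ball c ε ∈ 𝓝 (h, y) :=
    prod_mem_nhds (ball_mem_nhds h hε) (isOpen_ball.mem_nhds hy)
  filter_upwards [hn] with p hp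
  obtain ⟨x, hx, hxp⟩ := ht2 p.1 p.2 (fun x hx => by
    rw [← hh x hx]
    exact (ContinuousMap.dist_apply_le_dist x).trans (mem_ball.1 hp.1).le) (mem_ball.1 hp.2).le
  exact ⟨x, ⟨hMV hx.1, hx.2⟩, hxp⟩

lemma exists_perturbation_richPacking
    (hbo : ∀ V ∈ 𝓑, IsOpen V) (hb : ∀ U, IsOpen U → ∀ x ∈ U, ∃ V ∈ 𝓑, x ∈ V ∧ closure V ⊆ U)
    (hQc : IsClosed Q) (hQ : ∀ V, IsOpen V → (V ∩ Q).Nonempty → ¬ DimLt n (V ∩ Q))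
    {q : ℝ≥0} (hq : 0 < q)
    (hpack : ∀ V, IsOpen V → (V ∩ Q).Nonempty → packPre0 (fun r => r ^ (q : ℝ)) (V ∩ Q) = ∞)
    {V : Set K} (hV : IsOpen V) (k : ℕ) {B : Set (Fin n → ℝ)} (hB : IsCompact B)
    (f : C(K, Fin n → ℝ)) (hf : ∀ y ∈ B, ∃ x ∈ V ∩ Q, f x = y) {η : ℝ} (hη : 0 < η) :
    ∃ h : C(K, Fin n → ℝ), dist h f ≤ η ∧
      ∀ y ∈ B, RichPacking 𝓑 q (fun V' => (h, y) ∈ stable n (V' ∩ Q)) V k := by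
  have hε : 0 < η / 3 := by positivity
  obtain ⟨t, htB, htf, htc⟩ := hB.finite_cover_balls hε
  have : Finite t := htf
  choose x hx hfx using fun c : t => hf c (htB c.2)
  obtain ⟨U, hU, hUd⟩ := (finite_range x).t2_separation
  let N : t → Set K := fun c => U (x c) ∩ V ∩ f ⁻¹' ball (c : Fin n → ℝ) (η / 3)
  have hNo : ∀ c, IsOpen (N c) := fun c =>
    ((hU _).2.inter hV).inter (isOpen_ball.preimage f.continuous)
  have hNx : ∀ c, x c ∈ N c ∩ Q := fun c => ⟨⟨⟨(hU _).1, (hx c).1⟩, by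
    rw [mem_preimage, hfx]; exact mem_ball_self hε⟩, (hx c).2⟩
  have hNd : ∀ c c', c ≠ c' → Disjoint (N c) (N c') := fun c c' hne =>
    (hUd (mem_range_self c) (mem_range_self c') fun h => hne (Subtype.ext (by
      rw [← hfx c, ← hfx c', h]))).mono (fun z hz => hz.1.1) (fun z hz => hz.1.1)
  have hk : (0 : ℝ≥0) < ((k : ℝ≥0) + 1)⁻¹ := by positivity
  choose s hs1 hs2 hs3 using fun c =>
    exists_finset_packing hq (hpack _ (hNo c) ⟨_, hNx c⟩) hk ((k : ℝ≥0) + 1)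
  have hloc : ∀ i : Σ c : t, s c, ∃ V' ∈ 𝓑,
      closure V' ⊆ N i.1 ∩ ball i.2.1.1 ((i.2.1.2 : ℝ) / 2) ∧ ∃ L ⊆ V', IsClosed L ∧
      ∃ T : C(K, Fin n → ℝ), (∀ x j, |T x j - (i.1 : Fin n → ℝ) j| ≤ 2 * (η / 3)) ∧
      ∀ h : C(K, Fin n → ℝ), (∀ x ∈ L, h x = T x) → ∀ y, dist y (i.1 : Fin n → ℝ) < η / 3 →
        (h, y) ∈ stable n (V' ∩ Q) := fun i => by
    obtain ⟨h1, h2, -⟩ := hs1 i.1 i.2.1 i.2.2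
    exact exists_local_target hbo hb hQc hQ ((hNo i.1).inter isOpen_ball)
      ⟨h1.1, mem_ball_self (by positivity)⟩ h1.2 hε _
  choose V' hV' hV'c L hLV hLc T hT1 hT2 using hloc
  have hLN : ∀ i, L i ⊆ N i.1 ∩ ball i.2.1.1 ((i.2.1.2 : ℝ) / 2) := fun i =>
    (hLV i).trans (subset_closure.trans (hV'c i))
  have hLd : Pairwise (Function.onFun Disjoint L) := by
    rintro ⟨c, p⟩ ⟨c', p'⟩ hne
    by_cases hcc : c = c'
    · subst hcc
      have hpp : (p : K × ℝ≥0) ≠ p' := fun h => hne (by rw [Subtype.ext h])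
      refine (hs2 c p.2 p'.2 hpp).mono ?_ ?_
      · refine (hLN ⟨c, p⟩).trans (inter_subset_right.trans ?_)
        exact (ball_subset_ball (half_le_self p.1.2.2)).trans ball_subset_closedBall
      · refine (hLN ⟨c, p'⟩).trans (inter_subset_right.trans ?_)
        exact (ball_subset_ball (half_le_self p'.1.2.2)).trans ball_subset_closedBall
    · exact (hNd c c' hcc).mono ((hLN ⟨c, p⟩).trans inter_subset_left)
        ((hLN ⟨c', p'⟩).trans inter_subset_left)
  obtain ⟨h, hh1, hh2⟩ := exists_perturbation (L := fun _ => L) (fun _ => hLc) (fun _ => hLd) f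
    (fun j i => coordMap (T i) j) hη.le (fun j i z hz => by
      have e1 : |f z j - (i.1 : Fin n → ℝ) j| ≤ η / 3 :=
        ((Real.dist_eq _ _).symm.trans_le (dist_le_pi_dist (f z) _ j)).trans
          (mem_ball.1 (hLN i hz).1.2).le
      have e2 := hT1 i z j
      change |T i z j - f z j| ≤ η
      rw [abs_le] at *
      constructor <;> linarith)
  refine ⟨h, hh2, fun y hy => ?_⟩
  obtain ⟨c, hc, hyc⟩ := mem_iUnion₂.1 (htc hy)
  refine ⟨s ⟨c, hc⟩, fun p hp => (hs1 _ p hp).2.2, hs2 _, hs3 _, fun p hp => ?_⟩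
  refine ⟨V' ⟨⟨c, hc⟩, p, hp⟩, hV' _, (hV'c _).trans ?_, ?_⟩
  · exact inter_subset_inter_left _ fun z hz => hz.1.2
  · exact hT2 ⟨⟨c, hc⟩, p, hp⟩ h (fun z hz => funext fun j => hh1 j _ z hz) y hyc

lemma eventually_richPacking
    (hbo : ∀ V ∈ 𝓑, IsOpen V) (hb : ∀ U, IsOpen U → ∀ x ∈ U, ∃ V ∈ 𝓑, x ∈ V ∧ closure V ⊆ U)
    (hQc : IsClosed Q) (hQ : ∀ V, IsOpen V → (V ∩ Q).Nonempty → ¬ DimLt n (V ∩ Q))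
    {q : ℝ≥0} (hq : 0 < q)
    (hpack : ∀ V, IsOpen V → (V ∩ Q).Nonempty → packPre0 (fun r => r ^ (q : ℝ)) (V ∩ Q) = ∞)
    {V : Set K} (hV : IsOpen V) (k : ℕ) :
    ∀ᶠ f : C(K, Fin n → ℝ) in residual C(K, Fin n → ℝ), ∀ y, (f, y) ∈ stable n (V ∩ Q) →
      RichPacking 𝓑 q (fun V' => (f, y) ∈ stable n (V' ∩ Q)) V k := by
  obtain ⟨b, hbc, -, -, hbb⟩ := exists_countable_regular_base (Fin n → ℝ)
  have h1 : ∀ᶠ f : C(K, Fin n → ℝ) in residual C(K, Fin n → ℝ), ∀ W ∈ b, IsCompact (closure W) →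
      (∀ y ∈ closure W, (f, y) ∈ stable n (V ∩ Q)) → ∀ y ∈ closure W,
      RichPacking 𝓑 q (fun V' => (f, y) ∈ stable n (V' ∩ Q)) V k := by
    rw [eventually_countable_ball hbc]
    intro W _
    by_cases hW : IsCompact (closure W)
    swap
    · exact Eventually.of_forall fun f h => absurd h hW
    let C : Set C(K, Fin n → ℝ) := {f | ∀ y ∈ closure W,
      RichPacking 𝓑 q (fun V' => (f, y) ∈ stable n (V' ∩ Q)) V k}
    have hC : IsOpen C := by
      rw [isOpen_iff_eventually]
      intro f hf
      refine hW.eventually_forall_of_forall_eventually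
        (P := fun f y => RichPacking 𝓑 q (fun V' => (f, y) ∈ stable n (V' ∩ Q)) V k) fun y hy => ?_
      exact (isOpen_richPacking q V k).mem_nhds (hf y hy)
    have h2 : C ∪ (closure C)ᶜ ∈ residual C(K, Fin n → ℝ) := by
      refine residual_of_dense_open (hC.union isClosed_closure.isOpen_compl) fun f => ?_
      by_cases hf : f ∈ closure C
      · exact closure_mono subset_union_left hf
      · exact subset_closure (Or.inr hf)
    filter_upwards [h2] with f hf _ hst
    refine hf.resolve_right fun hfC => hfC ?_
    rw [Metric.mem_closure_iff]
    intro ε hε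
    obtain ⟨h, hh1, hh2⟩ := exists_perturbation_richPacking hbo hb hQc hQ hq hpack hV k hW f
      (fun y hy => exists_of_mem_stable (hst y hy)) (half_pos hε)
    refine ⟨h, hh2, ?_⟩
    rw [dist_comm]
    linarith
  filter_upwards [h1] with f hf y hy
  obtain ⟨W, hW, hyW, hWc⟩ := hbb
    (((fun y => (f, y)) ⁻¹' stable n (V ∩ Q)) ∩ ball y 1)
    (((isOpen_stable _).preimage (by fun_prop)).inter isOpen_ball) y ⟨hy, mem_ball_self one_pos⟩
  refine hf W hW ?_ (fun y' hy' => (hWc hy').1) y (subset_closure hyW)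
  exact (isCompact_closedBall y 1).of_isClosed_subset isClosed_closure
    (hWc.trans (inter_subset_right.trans ball_subset_closedBall))

lemma eventually_exists_mem_stable
    (hQc : IsClosed Q) (hQne : Q.Nonempty)
    (hQ : ∀ V, IsOpen V → (V ∩ Q).Nonempty → ¬ DimLt n (V ∩ Q)) :
    ∀ᶠ f : C(K, Fin n → ℝ) in residual C(K, Fin n → ℝ), ∃ y, (f, y) ∈ stable n Q := by
  obtain ⟨x, hx⟩ := hQne
  obtain ⟨𝓑, -, hbo, -, hb⟩ := exists_countable_regular_base K
  have h1 : ∀ᶠ f : C(K, Fin n → ℝ) in residual C(K, Fin n → ℝ), f ∈ Prod.fst '' stable n Q := by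
    refine residual_of_dense_open (isOpenMap_fst _ (isOpen_stable _)) ?_
    rw [Metric.dense_iff]
    intro f r hr
    have hε : 0 < r / 6 := by positivity
    obtain ⟨V, -, hVN, L, hLV, hL, t, ht1, ht2⟩ := exists_local_target hbo hb hQc hQ
      (isOpen_ball.preimage f.continuous) (mem_ball_self hε : f x ∈ ball (f x) (r / 6)) hx hε (f x)
    obtain ⟨h, hh1, hh2⟩ := exists_perturbation (ι := Unit) (L := fun _ _ => L) (fun _ _ => hL)
      (fun _ => Subsingleton.pairwise) f (fun j _ => coordMap t j) (half_pos hr).le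
      (fun j _ z hz => by
        have e1 : |f z j - f x j| ≤ r / 6 :=
          ((Real.dist_eq _ _).symm.trans_le (dist_le_pi_dist (f z) (f x) j)).trans
            (mem_ball.1 (hVN (subset_closure (hLV hz)))).le
        have e2 := ht1 z j
        change |t z j - f z j| ≤ r / 2
        rw [abs_le] at *
        constructor <;> linarith)
    refine ⟨h, by rw [mem_ball]; linarith, ⟨(h, f x), ?_, rfl⟩⟩
    refine stable_mono inter_subset_right
      (ht2 h (fun z hz => funext fun j => hh1 j () z hz) _ ?_)
    rwa [dist_self]
  filter_upwards [h1] with f hf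
  obtain ⟨p, hp, rfl⟩ := hf
  exact ⟨p.2, hp⟩

lemma eventually_le_pdim_fiber {q : ℝ≥0} (hq : 0 < q)
    (h : ¬ SmallModulo (fun A : Set K => pdim A ≤ ((q : ℝ) : EReal)) n univ) :
    ∀ᶠ f : C(K, Fin n → ℝ) in residual C(K, Fin n → ℝ),
      ∃ U : Set (Fin n → ℝ), IsOpen U ∧ U.Nonempty ∧
        ∀ y ∈ U, ((q : ℝ) : EReal) ≤ pdim (f ⁻¹' {y}) := by
  have hP := isClosedIdeal_pdim_le (K := K) q
  obtain ⟨Q, hQc, hQne, hQs⟩ := hP.exists_kernel h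
  have hQ : ∀ V, IsOpen V → (V ∩ Q).Nonempty → ¬ DimLt n (V ∩ Q) := by
    intro V hV hne hd
    obtain ⟨F, hF, -, hFV, -⟩ := hV.exists_iUnion_isClosed
    have e : ⋃ i, F i ∩ Q = V ∩ Q := by rw [← iUnion_inter, hFV]
    refine hQs V hV hne ⟨fun i => F i ∩ Q, fun i => (hF i).inter hQc, e ▸ hd, ?_⟩
    rw [e, sdiff_self]
    exact hP.empty
  have hpack : ∀ V, IsOpen V → (V ∩ Q).Nonempty →
      packPre0 (fun r => r ^ (q : ℝ)) (V ∩ Q) = ∞ := by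
    intro V hV hne
    have h1 : ((q : ℝ) : EReal) < pdim (V ∩ Q) := by
      by_contra! h2
      refine hQs V hV hne ⟨fun _ => ∅, fun _ => isClosed_empty, ?_, ?_⟩
      · rw [iUnion_empty]
        exact (dimLt_zero_iff.2 rfl).of_le (Nat.zero_le n)
      · exact hP.mono _ _ sdiff_subset h2
    exact top_le_iff.1 ((packMeasure_eq_top_of_lt_pdim h1).symm.le.trans (packMeasure_le_packPre0 _ _))
  obtain ⟨𝓑, hbc, hbo, hbu, hb⟩ := exists_countable_regular_base K
  have hrich : ∀ᶠ f : C(K, Fin n → ℝ) in residual C(K, Fin n → ℝ), ∀ V ∈ 𝓑, ∀ k, ∀ y,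
      (f, y) ∈ stable n (V ∩ Q) →
      RichPacking 𝓑 q (fun V' => (f, y) ∈ stable n (V' ∩ Q)) V k := by
    rw [eventually_countable_ball hbc]
    intro V hV
    rw [eventually_countable_forall]
    exact fun k => eventually_richPacking hbo hb hQc hQ hq hpack (hbo V hV) k
  filter_upwards [hrich, eventually_exists_mem_stable hQc hQne hQ] with f hf hy
  refine ⟨(fun y => (f, y)) ⁻¹' stable n (univ ∩ Q), (isOpen_stable _).preimage (by fun_prop), ?_,
    fun y hyU => ?_⟩
  · rwa [univ_inter]
  · refine le_pdim_of_richPacking hbo hbu hb (Φ := fun V => (f, y) ∈ stable n (V ∩ Q))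
      (fun V W hVW hV => stable_mono (inter_subset_inter_left _ hVW) hV)
      (isClosed_singleton.preimage f.continuous) (fun V hV => ?_) hyU
      (fun V hV hΦ k => hf V hV k y hΦ)
    obtain ⟨x, hx, hxy⟩ := exists_of_mem_stable hV
    exact ⟨x, hx.1, hxy⟩

end StableValues

section MainTheorem

variable {K : Type*} [MetricSpace K] {n : ℕ}

lemma IsDimension.finite_le {dim : Set K → EReal} (hdim : IsDimension dim) {E : Set K}
    (hE : E.Finite) : dim E ≤ 0 := by
  rcases E.eq_empty_or_nonempty with rfl | hne
  · rw [hdim.empty]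
    norm_num
  · obtain ⟨u, hu⟩ := hE.countable.exists_eq_range hne
    refine hdim.closed_cover E (fun j => {u j}) 0 (fun j => isClosed_singleton) ?_ fun j => ?_
    · rw [hu, iUnion_singleton_eq_range]
    · exact (hdim.mono _ _ inter_subset_right).trans (hdim.singleton _)

lemma IsDimension.le_of_finite_inter {dim : Set K → EReal} (hdim : IsDimension dim) {A F : Set K}
    (hE : (A ∩ F).Finite) {D : EReal} (hD : 0 ≤ D) (hF : dim Fᶜ ≤ D) : dim A ≤ D := by
  obtain ⟨L, hL, -, hLE, -⟩ := hE.isClosed.isOpen_compl.exists_iUnion_isClosed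
  refine hdim.closed_cover A (fun j => Nat.casesOn j (A ∩ F) L) D (fun j => ?_) (fun x hx => ?_)
    fun j => ?_
  · cases j
    exacts [hE.isClosed, hL _]
  · by_cases hxF : x ∈ F
    · exact mem_iUnion.2 ⟨0, hx, hxF⟩
    · obtain ⟨j, hj⟩ := mem_iUnion.1 (hLE.ge fun h : x ∈ A ∩ F => hxF h.2)
      exact mem_iUnion.2 ⟨j + 1, hj⟩
  · cases j with
    | zero => exact (hdim.finite_le (hE.subset inter_subset_right)).trans hD
    | succ j =>
      refine (hdim.mono (A ∩ L j) Fᶜ fun x hx hxF => ?_).trans hF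
      exact hLE.le (mem_iUnion.2 ⟨j, hx.2⟩) ⟨hx.1, hxF⟩

variable [CompactSpace K]

lemma dStar_le_of_closed {dim : Set K → EReal} {C : ℕ → Set K} (hC : ∀ i, IsClosed (C i))
    (hd : DimLt n (⋃ i, C i)) : dStar dim n univ ≤ dim (⋃ i, C i)ᶜ := by
  rw [compl_eq_univ_sdiff]
  exact sInf_le ⟨_, ⟨C, hC, by simp only [inter_univ]⟩, tdim_le_of_dimLt hd, rfl⟩

lemma not_smallModulo_of_lt_dStar {dim : Set K → EReal} {c : EReal} (hc : c < dStar dim n univ) :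
    ¬ SmallModulo (fun A => dim A ≤ c) n univ := by
  rintro ⟨C, h1, h2, h3⟩
  rw [← compl_eq_univ_sdiff] at h3
  exact hc.not_ge ((dStar_le_of_closed h1 h2).trans h3)

lemma exists_dStar_eq {dim : Set K → EReal} (hdim : IsDimension dim) (n : ℕ) :
    ∃ C : ℕ → Set K, (∀ i, IsClosed (C i)) ∧ DimLt n (⋃ i, C i) ∧
      dim (⋃ i, C i)ᶜ = dStar dim n univ := by
  obtain ⟨u, -, hu, huS⟩ := exists_seq_tendsto_sInf (S := {d : EReal |
    ∃ F : Set K, IsFSigmaIn F univ ∧ tdim F ≤ (n : EReal) - 1 ∧ d = dim (univ \ F)})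
    ⟨_, ∅, ⟨fun _ => ∅, fun _ => isClosed_empty, by simp⟩,
      tdim_le_of_dimLt ((dimLt_zero_iff.2 rfl).of_le (Nat.zero_le n)), rfl⟩ (OrderBot.bddBelow _)
  choose F hF hFd huF using huS
  choose C hC hFC using hF
  have hCF : ∀ m : ℕ, C m.unpair.1 m.unpair.2 ⊆ F m.unpair.1 := fun m x hx => by
    rw [hFC]
    exact mem_iUnion.2 ⟨_, hx, mem_univ x⟩
  have hd : DimLt n (⋃ m : ℕ, C m.unpair.1 m.unpair.2) :=
    dimLt_of_closed_cover (fun m => hC _ _) subset_rfl fun m =>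
      (tdim_le_natCast_sub_one_iff.1 (hFd m.unpair.1)).mono (inter_subset_right.trans (hCF m))
  refine ⟨fun m => C m.unpair.1 m.unpair.2, fun m => hC _ _, hd, le_antisymm ?_
    (dStar_le_of_closed (fun m => hC _ _) hd)⟩
  refine ge_of_tendsto' hu fun k => ?_
  rw [huF, ← compl_eq_univ_sdiff]
  refine hdim.mono _ _ (compl_subset_compl.2 fun x hx => ?_)
  rw [hFC] at hx
  obtain ⟨i, hi, -⟩ := mem_iUnion.1 hx
  exact mem_iUnion.2 ⟨Nat.pair k i, by simpa using hi⟩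

lemma eventually_nonempty_fiber (hd : ¬ DimLt n (univ : Set K)) :
    ∀ᶠ f : C(K, Fin n → ℝ) in residual C(K, Fin n → ℝ),
      ∃ U : Set (Fin n → ℝ), IsOpen U ∧ U.Nonempty ∧ ∀ y ∈ U, (f ⁻¹' {y}).Nonempty := by
  filter_upwards [isSmallness_empty.eventually_exists_open_fibers fun h => hd h.dimLt] with f hf
  obtain ⟨U, hU, hne, h⟩ := hf
  exact ⟨U, hU, hne, fun y hy => nonempty_iff_ne_empty.2 (h y hy)⟩

lemma eventually_le_tdim_fiber {q : ℝ≥0}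
    (hq : ((q : ℝ) : EReal) < dStar (tdim : Set K → EReal) n univ) :
    ∀ᶠ f : C(K, Fin n → ℝ) in residual C(K, Fin n → ℝ),
      ∃ U : Set (Fin n → ℝ), IsOpen U ∧ U.Nonempty ∧
        ∀ y ∈ U, ((q : ℝ) : EReal) ≤ tdim (f ⁻¹' {y}) := by
  have hcast : ∀ m : ℕ, ((m + 1 : ℕ) : EReal) - 1 = ((m : ℝ) : EReal) := fun m => by
    rw [show ((m + 1 : ℕ) : EReal) = (((m + 1 : ℕ) : ℝ) : EReal) from rfl,
      show (1 : EReal) = ((1 : ℝ) : EReal) from rfl, ← EReal.coe_sub]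
    simp
  have hs : ¬ SmallModulo (DimLt (⌊q⌋₊ + 1)) n (univ : Set K) := by
    rintro ⟨C, h1, h2, h3⟩
    refine not_smallModulo_of_lt_dStar hq ⟨C, h1, h2, (tdim_le_of_dimLt h3).trans ?_⟩
    rw [hcast, EReal.coe_le_coe_iff]
    exact_mod_cast Nat.floor_le zero_le
  filter_upwards [(isSmallness_dimLt (⌊q⌋₊ + 1)).eventually_exists_open_fibers hs] with f hf
  obtain ⟨U, hU, hne, h⟩ := hf
  refine ⟨U, hU, hne, fun y hy => ?_⟩
  rcases tdim_eq_top_or (f ⁻¹' {y}) with ⟨h1, -⟩ | ⟨k, h1, h2⟩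
  · rw [h1]
    exact le_top
  · have hk : ⌊q⌋₊ + 1 + 1 ≤ k := by
      by_contra! hk
      exact h y hy ((h2 _).2 (by omega))
    rw [h1]
    refine le_trans ?_ (natCast_sub_one_le_iff.2 hk)
    rw [hcast, EReal.coe_le_coe_iff]
    exact_mod_cast (Nat.lt_floor_add_one q).le

lemma eventually_le_hdim_fiber {q : ℝ≥0}
    (hq : ((q : ℝ) : EReal) < dStar (hdim : Set K → EReal) n univ) :
    ∀ᶠ f : C(K, Fin n → ℝ) in residual C(K, Fin n → ℝ),
      ∃ U : Set (Fin n → ℝ), IsOpen U ∧ U.Nonempty ∧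
        ∀ y ∈ U, ((q : ℝ) : EReal) ≤ hdim (f ⁻¹' {y}) := by
  have hcast : ((q : ℝ≥0∞) : EReal) = ((q : ℝ) : EReal) := rfl
  have hs : ¬ SmallModulo (fun A : Set K => dimH A ≤ q) n (univ : Set K) := by
    rintro ⟨C, h1, h2, h3⟩
    refine not_smallModulo_of_lt_dStar hq ⟨C, h1, h2, ?_⟩
    change hdim _ ≤ _
    rw [hdim]
    split_ifs
    · exact le_trans (by norm_num) (EReal.coe_nonneg.2 q.2)
    · rw [← hcast]
      exact_mod_cast h3
  filter_upwards [(isSmallness_dimH q).eventually_exists_open_fibers hs] with f hf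
  obtain ⟨U, hU, hne, h⟩ := hf
  refine ⟨U, hU, hne, fun y hy => ?_⟩
  have h1 := h y hy
  rw [hdim, if_neg]
  · rw [← hcast]
    exact_mod_cast (not_le.1 h1).le
  · intro h2
    simp [h2] at h1

lemma eventually_le_dim_fiber {dim : Set K → EReal} (hdim : dim = tdim ∨ dim = hdim ∨ dim = pdim)
    (hd : ¬ DimLt n (univ : Set K)) {c : ℝ} (hc : (c : EReal) < dStar dim n univ) :
    ∀ᶠ f : C(K, Fin n → ℝ) in residual C(K, Fin n → ℝ),
      ∃ U : Set (Fin n → ℝ), IsOpen U ∧ U.Nonempty ∧ ∀ y ∈ U, (c : EReal) ≤ dim (f ⁻¹' {y}) := by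
  have hdim' : IsDimension dim := by
    rcases hdim with rfl | rfl | rfl
    exacts [isDimension_tdim, isDimension_hdim, isDimension_pdim]
  rcases le_or_gt c 0 with h0 | h0
  · filter_upwards [eventually_nonempty_fiber hd] with f hf
    obtain ⟨U, hU, hne, h⟩ := hf
    exact ⟨U, hU, hne, fun y hy =>
      (EReal.coe_nonpos.2 h0).trans (hdim'.nonneg _ (h y hy))⟩
  · lift c to ℝ≥0 using h0.le
    rcases hdim with rfl | rfl | rfl
    · exact eventually_le_tdim_fiber hc
    · exact eventually_le_hdim_fiber hc
    · exact eventually_le_pdim_fiber (NNReal.coe_pos.1 h0) (not_smallModulo_of_lt_dStar hc)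

end MainTheorem

end GenericFibers

open GenericFibers

/-- **Main Theorem** (technical version). -/
theorem stmt0 (n : ℕ) (hn : 0 < n) (K : Type*) [MetricSpace K] [CompactSpace K]
    (dimStar : Set K → EReal)
    (hdimStar : dimStar = tdim ∨ dimStar = hdim ∨ dimStar = pdim)
    (hK : (n : EReal) ≤ tdim (Set.univ : Set K)) :
    ∃ G : Set K, IsGδ G ∧ dimStar G = dStar dimStar n Set.univ ∧
      ∀ᶠ (f : C(K, Fin n → ℝ)) in residual C(K, Fin n → ℝ),
        (∀ y : Fin n → ℝ, (⇑f ⁻¹' {y} \ G).encard ≤ (n : ℕ∞) ∧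
          dimStar (⇑f ⁻¹' {y}) ≤ dStar dimStar n Set.univ) ∧
        (∀ d : EReal, d < dStar dimStar n Set.univ →
          ∃ U : Set (Fin n → ℝ), IsOpen U ∧ U.Nonempty ∧
            ∀ y ∈ U, d ≤ dimStar (⇑f ⁻¹' {y})) := by
  have hdim : IsDimension dimStar := by
    rcases hdimStar with rfl | rfl | rfl
    exacts [isDimension_tdim, isDimension_hdim, isDimension_pdim]
  have hd : ¬ DimLt n (univ : Set K) := by
    intro h
    have h1 := hK.trans (tdim_le_of_dimLt h)
    rw [show (n : EReal) = ((n : ℝ) : EReal) from rfl,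
      show (1 : EReal) = ((1 : ℝ) : EReal) from rfl, ← EReal.coe_sub, EReal.coe_le_coe_iff] at h1
    linarith
  obtain ⟨C, hC, hCd, hCD⟩ := exists_dStar_eq hdim n
  have hD : 0 ≤ dStar dimStar n univ := by
    rw [← hCD]
    refine hdim.nonneg _ (nonempty_iff_ne_empty.2 fun h => hd ?_)
    rwa [compl_empty_iff.1 h] at hCd
  refine ⟨(⋃ i, C i)ᶜ, ?_, hCD, ?_⟩
  · rw [compl_iUnion]
    exact .iInter_of_isOpen fun i => (hC i).isOpen_compl
  have hlow : ∀ᶠ f : C(K, Fin n → ℝ) in residual C(K, Fin n → ℝ), ∀ q : ℚ,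
      ((q : ℝ) : EReal) < dStar dimStar n univ → ∃ U : Set (Fin n → ℝ), IsOpen U ∧ U.Nonempty ∧
        ∀ y ∈ U, ((q : ℝ) : EReal) ≤ dimStar (f ⁻¹' {y}) := by
    rw [eventually_countable_forall]
    intro q
    by_cases hq : ((q : ℝ) : EReal) < dStar dimStar n univ
    · filter_upwards [eventually_le_dim_fiber hdimStar hd hq] with f hf _
      exact hf
    · exact Eventually.of_forall fun f h => absurd h hq
  filter_upwards [eventually_encard_fiber_inter_le hC hCd, hlow] with f hf1 hf2
  refine ⟨fun y => ⟨?_, ?_⟩, fun d hd => ?_⟩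
  · rw [sdiff_compl]
    exact hf1 y
  · exact hdim.le_of_finite_inter (finite_of_encard_le_coe (hf1 y)) hD hCD.le
  · obtain ⟨q, hdq, hqD⟩ := EReal.lt_iff_exists_rat_btwn.1 hd
    obtain ⟨U, hU, hne, h⟩ := hf2 q hqD
    exact ⟨U, hU, hne, fun y hy => hdq.le.trans (h y hy)⟩
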